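/- Let n ≥ 5, m ≥ 1, p = (n+4)/(n−4), and let u = (u_1,…,u_m) be a C⁴ solution of Δ²u_i = |u|^{p−1} u_i on ℝⁿ that is stable outside a compact set. Then u has finite energy: ∫_{ℝⁿ} |u|^{p+1} dx = Σ_i ∫_{ℝⁿ} |Δu_i|² dx < ∞. If moreover u is stable on all of ℝⁿ, then u_i ≡ 0 for every i. -/

import Mathlib

open MeasureTheory Metric Filter Real Set

noncomputable section

/-- `n`-dimensional Euclidean space. -/
abbrev Euc (n : ℕ) := EuclideanSpace ℝ (Fin n)

/-- Laplacian of a scalar function on Euclidean space. -/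
def lap {n : ℕ} (f : Euc n → ℝ) (x : Euc n) : ℝ :=
  ∑ i : Fin n, iteratedFDeriv ℝ 2 f x ![EuclideanSpace.single i 1, EuclideanSpace.single i 1]

/-- Stability (quadratic form) inequality for the fourth order Lane–Emden system, tested
against families of smooth compactly supported functions whose supports lie in `S`:
`Σ_i ∫ |u|^{p−1} φ_i² + (p−1) Σ_{i,j} ∫ |u|^{p−3} u_i u_j φ_i φ_j ≤ Σ_i ∫ |Δφ_i|²`.
(Since `‖u x‖ ^ (p−3)` is interpreted with `Real.rpow`, the term `|u|^{p−3} u_i u_j`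
vanishes on the set where `u = 0`, for any `p > 1`.) -/
def Stable2 (n m : ℕ) (p : ℝ) (u : Euc n → EuclideanSpace ℝ (Fin m))
    (S : Set (Euc n)) : Prop :=
  ∀ φ : Fin m → Euc n → ℝ,
    (∀ i, ContDiff ℝ (⊤ : ℕ∞) (φ i)) → (∀ i, HasCompactSupport (φ i)) →
    (∀ i, tsupport (φ i) ⊆ S) →
    (∑ i, ∫ x, ‖u x‖ ^ (p - 1) * (φ i x) ^ 2) +
      (p - 1) * ∑ i, ∑ j, ∫ x, ‖u x‖ ^ (p - 3) * u x i * u x j * φ i x * φ j x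
      ≤ ∑ i, ∫ x, (lap (φ i) x) ^ 2

open scoped ContDiff Convolution Topology

/-! ### Partial derivatives and the Laplacian -/

/-- The `i`-th partial derivative. -/
def partialDeriv {n : ℕ} (i : Fin n) (f : Euc n → ℝ) (x : Euc n) : ℝ :=
  fderiv ℝ f x (EuclideanSpace.single i 1)

/-- The pointwise inner product of the gradients of `f` and `g`. -/
def gradInner {n : ℕ} (f g : Euc n → ℝ) (x : Euc n) : ℝ :=
  ∑ i, partialDeriv i f x * partialDeriv i g x

section Calculus

variable {n : ℕ} {f g : Euc n → ℝ}

lemma ContDiff.partialDeriv {k l : WithTop ℕ∞} (hf : ContDiff ℝ l f) (hkl : k + 1 ≤ l)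
    (i : Fin n) : ContDiff ℝ k (partialDeriv i f) :=
  (hf.fderiv_right hkl).clm_apply contDiff_const

lemma lap_eq_sum_partialDeriv (hf : ContDiff ℝ 2 f) (x : Euc n) :
    lap f x = ∑ i, partialDeriv i (partialDeriv i f) x := by
  refine Finset.sum_congr rfl fun i _ => ?_
  have hd : DifferentiableAt ℝ (fderiv ℝ f) x :=
    ((hf.fderiv_right (m := 1) (by norm_num)).differentiable one_ne_zero) x
  have : partialDeriv i f = fun y => fderiv ℝ f y (EuclideanSpace.single i 1) := rfl
  rw [iteratedFDeriv_two_apply, this, _root_.partialDeriv,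
    fderiv_clm_apply hd (differentiableAt_const _)]
  simp

lemma ContDiff.lap {k l : WithTop ℕ∞} (hf : ContDiff ℝ l f) (hkl : k + 2 ≤ l) :
    ContDiff ℝ k (lap f) := by
  have h2 : ContDiff ℝ 2 f := hf.of_le (le_trans (by simp) hkl)
  have : _root_.lap f = fun x => ∑ i, _root_.partialDeriv i (_root_.partialDeriv i f) x :=
    funext (lap_eq_sum_partialDeriv h2)
  rw [this]
  refine ContDiff.sum fun i _ => ?_
  refine ContDiff.partialDeriv (l := k + 1) ?_ le_rfl i
  refine hf.partialDeriv ?_ i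
  rwa [add_assoc, one_add_one_eq_two]

lemma ContDiff.continuous_lap (hf : ContDiff ℝ 2 f) : Continuous (_root_.lap f) :=
  (hf.lap (k := 0) (by simp)).continuous

lemma ContDiff.continuous_partialDeriv (hf : ContDiff ℝ 2 f) (i : Fin n) :
    Continuous (_root_.partialDeriv i f) :=
  (hf.partialDeriv (k := 1) (by norm_num) i).continuous

lemma ContDiff.continuous_gradInner (hf : ContDiff ℝ 2 f) (hg : ContDiff ℝ 2 g) :
    Continuous (gradInner f g) :=
  continuous_finsetSum _ fun i _ =>
    (hf.continuous_partialDeriv i).mul (hg.continuous_partialDeriv i)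

lemma Filter.EventuallyEq.lap_eq {x : Euc n} (h : f =ᶠ[𝓝 x] g) : lap f x = lap g x := by
  simp only [_root_.lap, (h.iteratedFDeriv ℝ 2).eq_of_nhds]

lemma lap_eq_zero_of_notMem_tsupport {x : Euc n} (hx : x ∉ tsupport f) : lap f x = 0 := by
  rw [(notMem_tsupport_iff_eventuallyEq.1 hx).lap_eq]
  simp [lap]

lemma HasCompactSupport.lap (hf : HasCompactSupport f) : HasCompactSupport (lap f) :=
  HasCompactSupport.intro' hf (isClosed_tsupport f) fun _ => lap_eq_zero_of_notMem_tsupport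

lemma HasCompactSupport.partialDeriv (hf : HasCompactSupport f) (i : Fin n) :
    HasCompactSupport (_root_.partialDeriv i f) :=
  hf.fderiv_apply ℝ _

lemma HasCompactSupport.gradInner_right (hg : HasCompactSupport g) :
    HasCompactSupport (gradInner f g) :=
  HasCompactSupport.intro' hg (isClosed_tsupport g) fun x hx => by
    have h0 : fderiv ℝ g x = 0 := image_eq_zero_of_notMem_tsupport
      (fun h => hx (tsupport_fderiv_subset ℝ h))
    simp [gradInner, _root_.partialDeriv, h0]

lemma partialDeriv_mul {x : Euc n} (hf : DifferentiableAt ℝ f x) (hg : DifferentiableAt ℝ g x)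
    (i : Fin n) :
    partialDeriv i (fun y => f y * g y) x
      = f x * partialDeriv i g x + g x * partialDeriv i f x := by
  simp [partialDeriv, fderiv_fun_mul hf hg]

lemma lap_mul (hf : ContDiff ℝ 2 f) (hg : ContDiff ℝ 2 g) (x : Euc n) :
    lap (fun y => f y * g y) x = f x * lap g x + g x * lap f x + 2 * gradInner f g x := by
  rw [lap_eq_sum_partialDeriv (hf.mul hg), lap_eq_sum_partialDeriv hf, lap_eq_sum_partialDeriv hg,
    gradInner, Finset.mul_sum, Finset.mul_sum, Finset.mul_sum, ← Finset.sum_add_distrib,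
    ← Finset.sum_add_distrib]
  refine Finset.sum_congr rfl fun i _ => ?_
  have df := hf.differentiable two_ne_zero
  have dg := hg.differentiable two_ne_zero
  have dpf := (hf.partialDeriv (k := 1) (by norm_num) i).differentiable one_ne_zero
  have dpg := (hg.partialDeriv (k := 1) (by norm_num) i).differentiable one_ne_zero
  have h1 : partialDeriv i (fun y => f y * g y)
      = fun y => f y * partialDeriv i g y + g y * partialDeriv i f y :=
    funext fun y => partialDeriv_mul (df y) (dg y) i
  have h2 : partialDeriv i (fun y => f y * partialDeriv i g y + g y * partialDeriv i f y) x
      = partialDeriv i (fun y => f y * partialDeriv i g y) x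
        + partialDeriv i (fun y => g y * partialDeriv i f y) x := by
    have := fderiv_fun_add ((df x).mul (dpg x)) ((dg x).mul (dpf x))
    exact congrArg (fun L => L (EuclideanSpace.single i 1)) this
  rw [h1, h2, partialDeriv_mul (df x) (dpg x), partialDeriv_mul (dg x) (dpf x)]
  ring

lemma lap_sub (hf : ContDiff ℝ 2 f) (hg : ContDiff ℝ 2 g) (x : Euc n) :
    lap (fun y => f y - g y) x = lap f x - lap g x := by
  simp only [lap, ← Finset.sum_sub_distrib]
  refine Finset.sum_congr rfl fun i _ => ?_
  have := iteratedFDeriv_sub_apply (x := x) (hf.contDiffAt (x := x)) (hg.contDiffAt (x := x))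
  rw [show (fun y => f y - g y) = f - g from rfl, this]
  rfl

lemma lap_const_mul (c : ℝ) (hf : ContDiff ℝ 2 f) (x : Euc n) :
    lap (fun y => c * f y) x = c * lap f x := by
  simp only [lap, Finset.mul_sum]
  refine Finset.sum_congr rfl fun i _ => ?_
  have := iteratedFDeriv_const_smul_apply (a := c) (x := x) (hf.contDiffAt (x := x))
  rw [show (fun y => c * f y) = c • f from rfl, this]
  rfl

lemma partialDeriv_comp_smul (c : ℝ) (f : Euc n → ℝ) (i : Fin n) (x : Euc n) :
    partialDeriv i (fun y => f (c • y)) x = c * partialDeriv i f (c • x) := by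
  simp [partialDeriv, fderiv_comp_smul]

lemma gradInner_comp_smul (c : ℝ) (f : Euc n → ℝ) (x : Euc n) :
    gradInner (fun y => f (c • y)) (fun y => f (c • y)) x = c ^ 2 * gradInner f f (c • x) := by
  simp only [gradInner, partialDeriv_comp_smul c f, Finset.mul_sum]
  exact Finset.sum_congr rfl fun i _ => by ring

lemma lap_comp_smul (c : ℝ) (hf : ContDiff ℝ 2 f) (x : Euc n) :
    lap (fun y => f (c • y)) x = c ^ 2 * lap f (c • x) := by
  have := iteratedFDeriv_comp_const_smul (𝕜 := ℝ) (i := 2) c hf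
  simp only [lap, Finset.mul_sum]
  refine Finset.sum_congr rfl fun i _ => ?_
  rw [congrFun this x]
  rfl

lemma partialDeriv_pow (hf : ContDiff ℝ 2 f) (k : ℕ) (i : Fin n) (x : Euc n) :
    partialDeriv i (fun y => f y ^ (k + 1)) x = (k + 1) * f x ^ k * partialDeriv i f x := by
  simp [partialDeriv, fderiv_fun_pow (k + 1) (hf.differentiable two_ne_zero x)]

lemma gradInner_pow (hf : ContDiff ℝ 2 f) (k : ℕ) (x : Euc n) :
    gradInner (fun y => f y ^ (k + 1)) (fun y => f y ^ (k + 1)) x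
      = (k + 1) ^ 2 * f x ^ (2 * k) * gradInner f f x := by
  simp only [gradInner, partialDeriv_pow hf, Finset.mul_sum]
  exact Finset.sum_congr rfl fun i _ => by ring

lemma lap_pow (hf : ContDiff ℝ 2 f) (k : ℕ) (x : Euc n) :
    lap (fun y => f y ^ (k + 2)) x
      = (k + 2) * f x ^ (k + 1) * lap f x + (k + 2) * (k + 1) * f x ^ k * gradInner f f x := by
  rw [lap_eq_sum_partialDeriv (hf.pow _), lap_eq_sum_partialDeriv hf, gradInner,
    Finset.mul_sum, Finset.mul_sum, ← Finset.sum_add_distrib]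
  refine Finset.sum_congr rfl fun i _ => ?_
  have dpf := (hf.partialDeriv (k := 1) (by norm_num) i).differentiable one_ne_zero
  have h1 : partialDeriv i (fun y => f y ^ (k + 2))
      = fun y => ((k + 2 : ℝ) * f y ^ (k + 1)) * partialDeriv i f y := by
    funext y
    rw [partialDeriv_pow hf (k + 1)]
    push_cast
    ring
  have h2 : partialDeriv i (fun y => (k + 2 : ℝ) * f y ^ (k + 1)) x
      = (k + 2) * ((k + 1) * f x ^ k * partialDeriv i f x) := by
    rw [← partialDeriv_pow hf]
    simp only [partialDeriv]
    rw [fderiv_const_mul (((hf.pow (k + 1)).differentiable two_ne_zero) x)]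
    rfl
  have d2 : DifferentiableAt ℝ (fun y => (k + 2 : ℝ) * f y ^ (k + 1)) x :=
    (((hf.pow (k + 1)).differentiable two_ne_zero) x).const_mul _
  rw [h1, partialDeriv_mul d2 (dpf x), h2]
  ring

/-- Integration by parts for one partial derivative. -/
lemma integral_mul_partialDeriv (hf : ContDiff ℝ 1 f) (hg : ContDiff ℝ 1 g)
    (hc : HasCompactSupport f ∨ HasCompactSupport g) (i : Fin n) :
    ∫ x, f x * partialDeriv i g x = - ∫ x, partialDeriv i f x * g x := by
  have cf : Continuous (partialDeriv i f) := (hf.partialDeriv (k := 0) (by simp) i).continuous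
  have cg : Continuous (partialDeriv i g) := (hg.partialDeriv (k := 0) (by simp) i).continuous
  have key : ∀ a b : Euc n → ℝ, Continuous a → Continuous b →
      (HasCompactSupport a ∨ HasCompactSupport b) → Integrable (fun x => a x * b x) := by
    intro a b ha hb h
    refine (ha.mul hb).integrable_of_hasCompactSupport ?_
    rcases h with h | h
    exacts [h.mul_right, h.mul_left]
  refine integral_mul_fderiv_eq_neg_fderiv_mul_of_integrable
    (key _ _ cf hg.continuous (hc.imp_left fun h => h.partialDeriv i))
    (key _ _ hf.continuous cg (hc.imp_right fun h => h.partialDeriv i))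
    (key _ _ hf.continuous hg.continuous hc)
    (fun x _ => hf.differentiable one_ne_zero x) (fun x _ => hg.differentiable one_ne_zero x)

/-- Green's second identity. -/
lemma integral_mul_lap_comm (hf : ContDiff ℝ 2 f) (hg : ContDiff ℝ 2 g)
    (hc : HasCompactSupport g) : ∫ x, f x * lap g x = ∫ x, lap f x * g x := by
  have hf1 : ContDiff ℝ 1 f := hf.of_le (by norm_num)
  have hg1 : ContDiff ℝ 1 g := hg.of_le (by norm_num)
  have pf := fun i => hf.partialDeriv (k := 1) (by norm_num) i
  have pg := fun i => hg.partialDeriv (k := 1) (by norm_num) i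
  simp only [lap_eq_sum_partialDeriv hf, lap_eq_sum_partialDeriv hg, Finset.mul_sum,
    Finset.sum_mul]
  rw [integral_finsetSum, integral_finsetSum]
  · refine Finset.sum_congr rfl fun i _ => ?_
    rw [integral_mul_partialDeriv hf1 (pg i) (.inr (hc.partialDeriv i)) i,
      integral_mul_partialDeriv (pf i) hg1 (.inr hc) i, neg_neg]
  · exact fun i _ => Continuous.integrable_of_hasCompactSupport
      (((pf i).partialDeriv (k := 0) (by simp) i).continuous.mul hg.continuous) hc.mul_left
  · exact fun i _ => Continuous.integrable_of_hasCompactSupport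
      (hf.continuous.mul ((pg i).partialDeriv (k := 0) (by simp) i).continuous)
      ((hc.partialDeriv i).partialDeriv i).mul_left

end Calculus

/-! ### Extension of the stability inequality to `C²` test functions -/

section Mollification

variable {n : ℕ}

lemma partialDeriv_convolution {ρ g : Euc n → ℝ} (hρ : Continuous ρ) (hg : ContDiff ℝ 1 g)
    (hc : HasCompactSupport g) (i : Fin n) :
    partialDeriv i (ρ ⋆[ContinuousLinearMap.lsmul ℝ ℝ, volume] g)
      = ρ ⋆[ContinuousLinearMap.lsmul ℝ ℝ, volume] partialDeriv i g := by
  funext x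
  have hρ' : LocallyIntegrable ρ (volume : Measure (Euc n)) := hρ.locallyIntegrable
  rw [partialDeriv, (hc.hasFDerivAt_convolution_right _ hρ' hg x).fderiv,
    convolution_precompR_apply _ hρ' (hc.fderiv ℝ) (hg.continuous_fderiv one_ne_zero)]
  rfl

lemma lap_convolution {ρ g : Euc n → ℝ} (hρ : Continuous ρ) (hg : ContDiff ℝ 2 g)
    (hc : HasCompactSupport g) (x : Euc n) :
    lap (ρ ⋆[ContinuousLinearMap.lsmul ℝ ℝ, volume] g) x
      = ∑ i, (ρ ⋆[ContinuousLinearMap.lsmul ℝ ℝ, volume] partialDeriv i (partialDeriv i g)) x := by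
  have h2 : ContDiff ℝ 2 (ρ ⋆[ContinuousLinearMap.lsmul ℝ ℝ, volume] g) := by
    exact_mod_cast hc.contDiff_convolution_right (n := 2) (ContinuousLinearMap.lsmul ℝ ℝ)
      hρ.locallyIntegrable (by exact_mod_cast hg)
  rw [lap_eq_sum_partialDeriv h2]
  refine Finset.sum_congr rfl fun i _ => ?_
  rw [partialDeriv_convolution hρ (hg.of_le (by norm_num)) hc,
    partialDeriv_convolution hρ (hg.partialDeriv (by norm_num) i) (hc.partialDeriv i)]

lemma exists_smooth_approx {φ : Euc n → ℝ} {S : Set (Euc n)} (hS : IsOpen S)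
    (hφ : ContDiff ℝ 2 φ) (hc : HasCompactSupport φ) (hsub : tsupport φ ⊆ S) :
    ∃ (ψ : ℕ → Euc n → ℝ) (K : Set (Euc n)) (C : ℝ), IsCompact K ∧
      (∀ N, ContDiff ℝ (⊤ : ℕ∞) (ψ N)) ∧ (∀ N, tsupport (ψ N) ⊆ K) ∧
      (∀ N, tsupport (ψ N) ⊆ S) ∧ (∀ N x, |ψ N x| ≤ C) ∧ (∀ N x, |lap (ψ N) x| ≤ C) ∧
      (∀ x, Tendsto (fun N => ψ N x) atTop (𝓝 (φ x))) ∧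
      (∀ x, Tendsto (fun N => lap (ψ N) x) atTop (𝓝 (lap φ x))) := by
  obtain ⟨δ, hδ, hδS⟩ := hc.isCompact.exists_cthickening_subset_open hS hsub
  have hr : ∀ N : ℕ, 0 < δ / (N + 1) / 2 := fun N => by positivity
  let ρ : ℕ → ContDiffBump (0 : Euc n) := fun N =>
    ⟨δ / (N + 1) / 2, δ / (N + 1), hr N, half_lt_self (by positivity)⟩
  have hρr : ∀ N, (ρ N).rOut ≤ δ := fun N => div_le_self hδ.le (by simp)
  have hρ0 : Tendsto (fun N => (ρ N).rOut) atTop (𝓝 0) :=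
    tendsto_const_nhds.div_atTop
      (tendsto_natCast_atTop_atTop.atTop_add tendsto_const_nhds)
  have hρc : ∀ N, Continuous ((ρ N).normed volume) := fun N =>
    ((ρ N).contDiff_normed (n := 0)).continuous
  have hbound : ∀ g : Euc n → ℝ, Continuous g → HasCompactSupport g → ∃ C, ∀ N x,
      |((ρ N).normed volume ⋆[ContinuousLinearMap.lsmul ℝ ℝ, volume] g) x| ≤ C := by
    intro g hg hgc
    obtain ⟨C, hC⟩ := hgc.exists_bound_of_continuous hg
    refine ⟨C, fun N x => ?_⟩
    have := dist_convolution_le (x₀ := x) (z₀ := 0) (g := g) ((norm_nonneg (g 0)).trans (hC 0))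
      ((ρ N).support_normed_eq (μ := volume)).subset (ρ N).nonneg_normed (ρ N).integral_normed
      hg.aestronglyMeasurable (fun y _ => by simpa using hC y)
    simpa using this
  have hpp : ∀ i, Continuous (partialDeriv i (partialDeriv i φ)) := fun i =>
    ((hφ.partialDeriv (k := 1) (by norm_num) i).partialDeriv (k := 0) (by simp) i).continuous
  obtain ⟨C₀, hC₀⟩ := hbound φ hφ.continuous hc
  choose C₁ hC₁ using fun i => hbound _ (hpp i) ((hc.partialDeriv i).partialDeriv i)
  have hK : IsCompact (cthickening δ (tsupport φ)) := hc.isCompact.cthickening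
  have hsupp : ∀ N, tsupport ((ρ N).normed volume ⋆[ContinuousLinearMap.lsmul ℝ ℝ, volume] φ)
      ⊆ cthickening δ (tsupport φ) := by
    intro N
    refine closure_minimal ?_ isClosed_cthickening
    refine (support_convolution_subset _).trans ?_
    rintro _ ⟨y, hy, z, hz, rfl⟩
    rw [(ρ N).support_normed_eq] at hy
    refine mem_cthickening_of_dist_le _ z _ _ (subset_tsupport _ hz) ?_
    have : ‖y‖ < (ρ N).rOut := by simpa using hy
    simpa using this.le.trans (hρr N)
  refine ⟨fun N => (ρ N).normed volume ⋆[ContinuousLinearMap.lsmul ℝ ℝ, volume] φ,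
    cthickening δ (tsupport φ), max C₀ (∑ i, C₁ i), hK, fun N => ?_, hsupp,
    fun N => (hsupp N).trans hδS, fun N x => (hC₀ N x).trans (le_max_left _ _), fun N x => ?_,
    fun x => ContDiffBump.convolution_tendsto_right_of_continuous hρ0 hφ.continuous x,
    fun x => ?_⟩
  · exact (ρ N).hasCompactSupport_normed.contDiff_convolution_left _ (ρ N).contDiff_normed
      hφ.continuous.locallyIntegrable
  · rw [lap_convolution (hρc N) hφ hc]
    exact ((Finset.abs_sum_le_sum_abs _ _).trans
      (Finset.sum_le_sum fun i _ => hC₁ i N x)).trans (le_max_right _ _)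
  · simp only [lap_convolution (hρc _) hφ hc, lap_eq_sum_partialDeriv hφ]
    exact tendsto_finsetSum _ fun i _ =>
      ContDiffBump.convolution_tendsto_right_of_continuous hρ0 (hpp i) x

lemma tendsto_integral_mul_mul {h H : Euc n → ℝ} (hm : Measurable h) (hH : Continuous H)
    (hle : ∀ x, |h x| ≤ H x) {a b : ℕ → Euc n → ℝ} {a' b' : Euc n → ℝ} {K : Set (Euc n)}
    (hK : IsCompact K) {A B : ℝ} (ha : ∀ N, Continuous (a N)) (hb : ∀ N, Continuous (b N))
    (haK : ∀ N, tsupport (a N) ⊆ K) (haA : ∀ N x, |a N x| ≤ A) (hbB : ∀ N x, |b N x| ≤ B)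
    (hat : ∀ x, Tendsto (fun N => a N x) atTop (𝓝 (a' x)))
    (hbt : ∀ x, Tendsto (fun N => b N x) atTop (𝓝 (b' x))) :
    Tendsto (fun N => ∫ x, h x * a N x * b N x) atTop (𝓝 (∫ x, h x * a' x * b' x)) := by
  have hA : 0 ≤ A := (abs_nonneg _).trans (haA 0 0)
  refine tendsto_integral_of_dominated_convergence (K.indicator fun x => H x * A * B) ?_ ?_ ?_ ?_
  · exact fun N => ((hm.mul (ha N).measurable).mul (hb N).measurable).aestronglyMeasurable
  · rw [integrable_indicator_iff hK.measurableSet]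
    exact ((hH.mul continuous_const).mul continuous_const).continuousOn.integrableOn_compact hK
  · refine fun N => Eventually.of_forall fun x => ?_
    by_cases hx : x ∈ K
    · rw [indicator_of_mem hx, norm_mul, norm_mul]
      simp only [Real.norm_eq_abs]
      have h0 := (abs_nonneg _).trans (hle x)
      gcongr
      exacts [hle x, haA N x, hbB N x]
    · have : a N x = 0 := image_eq_zero_of_notMem_tsupport fun h' => hx (haK N h')
      simp [indicator_of_notMem hx, this]
  · exact Eventually.of_forall fun x => (tendsto_const_nhds.mul (hat x)).mul (hbt x)

lemma Stable2.le_of_contDiff_two {m : ℕ} {p : ℝ} {u : Euc n → EuclideanSpace ℝ (Fin m)}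
    {S : Set (Euc n)} (hst : Stable2 n m p u S) (hS : IsOpen S) (hp : 1 < p) (hu : Continuous u)
    {φ : Fin m → Euc n → ℝ} (hφ : ∀ i, ContDiff ℝ 2 (φ i)) (hc : ∀ i, HasCompactSupport (φ i))
    (hsub : ∀ i, tsupport (φ i) ⊆ S) :
    (∑ i, ∫ x, ‖u x‖ ^ (p - 1) * (φ i x) ^ 2) +
      (p - 1) * ∑ i, ∑ j, ∫ x, ‖u x‖ ^ (p - 3) * u x i * u x j * φ i x * φ j x
      ≤ ∑ i, ∫ x, (lap (φ i) x) ^ 2 := by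
  choose ψ K C hK hsm hψK hψS hb hlb hlim hllim using
    fun i => exists_smooth_approx hS (hφ i) (hc i) (hsub i)
  have hcs : ∀ i N, HasCompactSupport (ψ i N) := fun i N =>
    (hK i).of_isClosed_subset (isClosed_tsupport _) (hψK i N)
  have hcont : ∀ i N, Continuous (ψ i N) := fun i N => (hsm i N).continuous
  have hlcont : ∀ i N, Continuous (lap (ψ i N)) := fun i N =>
    (contDiff_infty.1 (hsm i N) 2).continuous_lap
  have hH : Continuous fun x => ‖u x‖ ^ (p - 1) :=
    hu.norm.rpow_const fun x => .inr (by linarith)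
  have hui : ∀ i, Continuous fun x => u x i := fun i =>
    (EuclideanSpace.proj (𝕜 := ℝ) i).continuous.comp hu
  have hineq := fun N => hst (fun i => ψ i N) (fun i => hsm i N) (fun i => hcs i N)
    (fun i => hψS i N)
  refine le_of_tendsto_of_tendsto' (b := atTop) (Tendsto.add (tendsto_finsetSum _ fun i _ => ?_)
    (Tendsto.const_mul _ (tendsto_finsetSum _ fun i _ => tendsto_finsetSum _ fun j _ => ?_)))
    (tendsto_finsetSum _ fun i _ => ?_) hineq
  · simp only [pow_two, ← mul_assoc]
    exact tendsto_integral_mul_mul hH.measurable hH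
      (fun x => (abs_of_nonneg (by positivity)).le) (hK i) (hcont i) (hcont i) (hψK i) (hb i)
      (hb i) (hlim i) (hlim i)
  · refine tendsto_integral_mul_mul ?_ hH (fun x => ?_) (hK i) (hcont i) (hcont j) (hψK i) (hb i)
      (hb j) (hlim i) (hlim j)
    · exact ((hu.norm.measurable.pow_const _).mul (hui i).measurable).mul (hui j).measurable
    · rcases eq_or_ne (u x) 0 with h0 | h0
      · simp only [h0, PiLp.zero_apply, mul_zero, abs_zero]
        positivity
      · have hn : 0 < ‖u x‖ := norm_pos_iff.2 h0
        rw [abs_mul, abs_mul, abs_of_nonneg (by positivity : 0 ≤ ‖u x‖ ^ (p - 3))]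
        calc ‖u x‖ ^ (p - 3) * |u x i| * |u x j| ≤ ‖u x‖ ^ (p - 3) * ‖u x‖ * ‖u x‖ := by
              gcongr
              exacts [PiLp.norm_apply_le (u x) i, PiLp.norm_apply_le (u x) j]
          _ = ‖u x‖ ^ (p - 1) := by
              rw [mul_assoc, ← pow_two, ← rpow_natCast, ← rpow_add hn]
              norm_num
              ring_nf
  · have := tendsto_integral_mul_mul (h := fun _ => 1) (H := fun _ => 1) measurable_const
      continuous_const (by simp) (hK i) (hlcont i) (hlcont i)
      (fun N => (closure_minimal (fun x hx => by
        by_contra h'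
        exact hx (lap_eq_zero_of_notMem_tsupport h')) (isClosed_tsupport _)).trans (hψK i N))
      (hlb i) (hlb i) (hllim i) (hllim i)
    simpa only [pow_two, one_mul] using this

end Mollification

/-! ### Stability tested against multiples of the solution -/

section StabilityEstimates

variable {n m : ℕ} {p : ℝ} {u : Euc n → EuclideanSpace ℝ (Fin m)}

lemma integrable_of_zero_off_tsupport {f g : Euc n → ℝ} (hf : Continuous f)
    (hg : HasCompactSupport g) (h : ∀ x, x ∉ tsupport g → f x = 0) : Integrable f :=
  hf.integrable_of_hasCompactSupport (HasCompactSupport.intro' hg (isClosed_tsupport g) h)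

lemma ContDiff.euclidean_coord {k : WithTop ℕ∞} (hu : ContDiff ℝ k u) (i : Fin m) :
    ContDiff ℝ k fun x => u x i :=
  (EuclideanSpace.proj (𝕜 := ℝ) i).contDiff.comp hu

lemma Stable2.integral_le_of_scalar {S : Set (Euc n)} (hst : Stable2 n m p u S) (hS : IsOpen S)
    (hp : 1 < p) (hu : ContDiff ℝ 2 u) {ξ : Euc n → ℝ} (hξ : ContDiff ℝ 2 ξ)
    (hc : HasCompactSupport ξ) (hsub : tsupport ξ ⊆ S) :
    p * ∫ x, ‖u x‖ ^ (p + 1) * ξ x ^ 2 ≤ ∑ i, ∫ x, (lap (fun y => u y i * ξ y) x) ^ 2 := by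
  have h := hst.le_of_contDiff_two hS hp hu.continuous (φ := fun i y => u y i * ξ y)
    (fun i => (hu.euclidean_coord i).mul hξ) (fun i => hc.mul_left)
    (fun i => (tsupport_mul_subset_right).trans hsub)
  refine le_trans (le_of_eq ?_) h
  have hH : Continuous fun x => ‖u x‖ ^ (p + 1) * ξ x ^ 2 :=
    (hu.continuous.norm.rpow_const fun x => .inr (by linarith)).mul (hξ.continuous.pow 2)
  have hHi : Integrable fun x => ‖u x‖ ^ (p + 1) * ξ x ^ 2 :=
    integrable_of_zero_off_tsupport hH hc fun x hx => by
      simp [image_eq_zero_of_notMem_tsupport hx]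
  have hui := fun i => (hu.euclidean_coord i).continuous
  have hsq : ∀ x, ∑ i, u x i ^ 2 = ‖u x‖ ^ 2 := fun x => (EuclideanSpace.real_norm_sq_eq _).symm
  have hpow : ∀ x, ‖u x‖ ^ (p - 1) * ‖u x‖ ^ 2 = ‖u x‖ ^ (p + 1) := fun x => by
    rcases eq_or_ne (u x) 0 with h0 | h0
    · simp [h0, zero_rpow (by linarith : p + 1 ≠ 0)]
    · rw [← rpow_natCast, ← rpow_add (norm_pos_iff.2 h0)]
      norm_num
      ring_nf
  have hpow' : ∀ x, ‖u x‖ ^ (p - 3) * (‖u x‖ ^ 2 * ‖u x‖ ^ 2) = ‖u x‖ ^ (p + 1) := fun x => by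
    rcases eq_or_ne (u x) 0 with h0 | h0
    · simp [h0, zero_rpow (by linarith : p + 1 ≠ 0)]
    · rw [← pow_add, ← rpow_natCast, ← rpow_add (norm_pos_iff.2 h0)]
      norm_num
      ring_nf
  have h1 : ∑ i, ∫ x, ‖u x‖ ^ (p - 1) * (u x i * ξ x) ^ 2 = ∫ x, ‖u x‖ ^ (p + 1) * ξ x ^ 2 := by
    rw [← integral_finsetSum]
    · congr 1
      funext x
      rw [← hpow, ← hsq, Finset.mul_sum, Finset.sum_mul]
      exact Finset.sum_congr rfl fun i _ => by ring
    · exact fun i _ => integrable_of_zero_off_tsupport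
        ((hu.continuous.norm.rpow_const fun x => .inr (by linarith)).mul
          (((hui i).mul hξ.continuous).pow 2)) hc
        fun x hx => by simp [image_eq_zero_of_notMem_tsupport hx]
  have h2 : ∑ i, ∑ j, ∫ x, ‖u x‖ ^ (p - 3) * u x i * u x j * (u x i * ξ x) * (u x j * ξ x)
      = ∫ x, ‖u x‖ ^ (p + 1) * ξ x ^ 2 := by
    have hint : ∀ i j, Integrable
        fun x => ‖u x‖ ^ (p - 3) * u x i * u x j * (u x i * ξ x) * (u x j * ξ x) := by
      intro i j
      refine hHi.mono' ?_ (Eventually.of_forall fun x => ?_)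
      · exact (((((hu.continuous.norm.measurable.pow_const _).mul (hui i).measurable).mul
          (hui j).measurable).mul ((hui i).mul hξ.continuous).measurable).mul
          ((hui j).mul hξ.continuous).measurable).aestronglyMeasurable
      · have h3 : ‖u x‖ ^ (p - 3) * u x i * u x j * (u x i * ξ x) * (u x j * ξ x)
            = ‖u x‖ ^ (p - 3) * (u x i ^ 2 * u x j ^ 2) * ξ x ^ 2 := by ring
        have hle : ∀ k, u x k ^ 2 ≤ ‖u x‖ ^ 2 := fun k =>
          sq_le_sq.2 (by simpa using PiLp.norm_apply_le (u x) k)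
        rw [h3, Real.norm_of_nonneg (by positivity), ← hpow']
        exact mul_le_mul_of_nonneg_right (mul_le_mul_of_nonneg_left
          (mul_le_mul (hle i) (hle j) (sq_nonneg _) (sq_nonneg _)) (by positivity)) (sq_nonneg _)
    simp only [← integral_finsetSum Finset.univ fun j _ => hint _ j]
    rw [← integral_finsetSum]
    · congr 1
      funext x
      rw [← hpow', ← hsq, Finset.sum_mul_sum, Finset.mul_sum, Finset.sum_mul]
      refine Finset.sum_congr rfl fun i _ => ?_
      rw [Finset.mul_sum, Finset.sum_mul]
      exact Finset.sum_congr rfl fun j _ => by ring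
    · exact fun i _ => integrable_finsetSum _ fun j _ => hint i j
  rw [h1, h2]
  ring

/-- Stability outside a compact set gives, up to a fixed additive constant, the stability
inequality for all cutoff functions which are `1` on a fixed large ball. -/
lemma Stable2.exists_const {R₀ : ℝ} (hR₀ : 0 < R₀)
    (hst : Stable2 n m p u (closure (ball (0 : Euc n) R₀))ᶜ) (hp : 1 < p) (hu : ContDiff ℝ 2 u) :
    ∃ C₀ R₁ : ℝ, ∀ ζ : Euc n → ℝ, ContDiff ℝ 2 ζ → HasCompactSupport ζ →
      (∀ x ∈ ball (0 : Euc n) R₁, ζ x = 1) →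
      p * ∫ x, ‖u x‖ ^ (p + 1) * ζ x ^ 2
        ≤ (∑ i, ∫ x, (lap (fun y => u y i * ζ y) x) ^ 2) + C₀ := by
  let χ : ContDiffBump (0 : Euc n) := ⟨R₀ + 1, R₀ + 2, by linarith, by linarith⟩
  have hχ : ContDiff ℝ 2 χ := χ.contDiff
  have hχc : HasCompactSupport χ := χ.hasCompactSupport
  have hui := fun i => hu.euclidean_coord i
  refine ⟨(∑ i, ∫ x, (lap (fun y => u y i * χ y) x ^ 2
      - 2 * (lap (fun y => u y i) x * lap (fun y => u y i * χ y) x)))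
      - p * ∫ x, ‖u x‖ ^ (p + 1) * (χ x ^ 2 - 2 * χ x), R₀ + 3, fun ζ hζ hζc hζ1 => ?_⟩
  have hnear : ∀ x ∈ tsupport χ, ζ =ᶠ[𝓝 x] fun _ => 1 := by
    intro x hx
    rw [χ.tsupport_eq] at hx
    have hx' : x ∈ ball (0 : Euc n) (R₀ + 3) :=
      closedBall_subset_ball (by change R₀ + 2 < R₀ + 3; linarith) hx
    filter_upwards [isOpen_ball.mem_nhds hx'] with y hy using hζ1 y hy
  have hξc : HasCompactSupport fun x => ζ x - χ x := by
    refine HasCompactSupport.intro' (hζc.isCompact.union hχc.isCompact)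
      ((isClosed_tsupport ζ).union (isClosed_tsupport χ)) fun x hx => ?_
    rw [mem_union, not_or] at hx
    rw [image_eq_zero_of_notMem_tsupport hx.1, image_eq_zero_of_notMem_tsupport hx.2, sub_zero]
  have hξs : tsupport (fun x => ζ x - χ x) ⊆ (closure (ball (0 : Euc n) R₀))ᶜ := by
    intro x hx hxb
    have hx' : x ∈ ball (0 : Euc n) (R₀ + 1) :=
      closedBall_subset_ball (by linarith) (closure_ball_subset_closedBall hxb)
    refine (notMem_tsupport_iff_eventuallyEq.2 ?_) hx
    filter_upwards [isOpen_ball.mem_nhds hx'] with y hy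
    rw [hζ1 y (ball_subset_ball (by linarith) hy),
      χ.one_of_mem_closedBall (ball_subset_closedBall hy), sub_self, Pi.zero_apply]
  have key := hst.integral_le_of_scalar isClosed_closure.isOpen_compl hp hu (hζ.sub hχ) hξc hξs
  have hpu : Continuous fun x => ‖u x‖ ^ (p + 1) :=
    hu.continuous.norm.rpow_const fun x => .inr (by linarith)
  have hl : ∫ x, ‖u x‖ ^ (p + 1) * (ζ x - χ x) ^ 2 = (∫ x, ‖u x‖ ^ (p + 1) * ζ x ^ 2)
      + ∫ x, ‖u x‖ ^ (p + 1) * (χ x ^ 2 - 2 * χ x) := by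
    rw [← integral_add]
    · congr 1
      funext x
      by_cases hx : x ∈ tsupport χ
      · rw [(hnear x hx).eq_of_nhds]
        ring
      · rw [image_eq_zero_of_notMem_tsupport hx]
        ring
    · exact integrable_of_zero_off_tsupport (hpu.mul (hζ.continuous.pow 2)) hζc fun x hx => by
        simp [image_eq_zero_of_notMem_tsupport hx]
    · exact integrable_of_zero_off_tsupport
        (hpu.mul ((hχ.continuous.pow 2).sub (continuous_const.mul hχ.continuous))) hχc
        fun x hx => by simp [image_eq_zero_of_notMem_tsupport hx]
  have hr : ∀ i, ∫ x, (lap (fun y => u y i * (ζ y - χ y)) x) ^ 2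
      = (∫ x, (lap (fun y => u y i * ζ y) x) ^ 2)
        + ∫ x, (lap (fun y => u y i * χ y) x ^ 2
          - 2 * (lap (fun y => u y i) x * lap (fun y => u y i * χ y) x)) := by
    intro i
    have h0 : ∀ x ∉ tsupport χ, lap (fun y => u y i * χ y) x = 0 := fun x hx =>
      lap_eq_zero_of_notMem_tsupport fun h => hx (tsupport_mul_subset_right h)
    rw [← integral_add]
    · congr 1
      funext x
      have hs : lap (fun y => u y i * (ζ y - χ y)) x
          = lap (fun y => u y i * ζ y) x - lap (fun y => u y i * χ y) x := by
        rw [← lap_sub ((hui i).mul hζ) ((hui i).mul hχ)]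
        simp only [mul_sub]
      rw [hs]
      by_cases hx : x ∈ tsupport χ
      · have : (fun y => u y i * ζ y) =ᶠ[𝓝 x] fun y => u y i := by
          filter_upwards [hnear x hx] with y hy
          rw [hy, mul_one]
        rw [this.lap_eq]
        ring
      · rw [h0 x hx]
        ring
    · refine integrable_of_zero_off_tsupport (((hui i).mul hζ).continuous_lap.pow 2) hζc
        fun x hx => ?_
      rw [lap_eq_zero_of_notMem_tsupport fun h => hx (tsupport_mul_subset_right h)]
      simp
    · refine integrable_of_zero_off_tsupport ((((hui i).mul hχ).continuous_lap.pow 2).sub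
        (continuous_const.mul ((hui i).continuous_lap.mul ((hui i).mul hχ).continuous_lap))) hχc
        fun x hx => ?_
      simp [h0 x hx]
  simp only [hl, hr, Finset.sum_add_distrib] at key
  linarith

end StabilityEstimates

/-! ### Energy identities with cutoff -/

section EnergyEstimates

variable {n : ℕ}

lemma gradInner_sq_le (f g : Euc n → ℝ) (x : Euc n) :
    gradInner f g x ^ 2 ≤ gradInner f f x * gradInner g g x := by
  have := Finset.sum_mul_sq_le_sq_mul_sq Finset.univ
    (fun i => partialDeriv i f x) (fun i => partialDeriv i g x)
  simpa only [gradInner, ← pow_two] using this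

lemma gradInner_self_nonneg (f : Euc n → ℝ) (x : Euc n) : 0 ≤ gradInner f f x :=
  Finset.sum_nonneg fun _ _ => mul_self_nonneg _

lemma gradInner_sq_right {f g : Euc n → ℝ} (hg : ContDiff ℝ 2 g) (x : Euc n) :
    gradInner f (fun y => g y ^ 2) x = 2 * g x * gradInner f g x := by
  have := partialDeriv_pow hg 1
  simp only [gradInner, Finset.mul_sum]
  refine Finset.sum_congr rfl fun i _ => ?_
  rw [this]
  push_cast
  ring

lemma le_mul_add_inv_mul {t a y ε : ℝ} (hε : 0 < ε) (ha : 0 ≤ a) (hy : 0 ≤ y)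
    (h : t ^ 2 ≤ a * y) : t ≤ ε * a + ε⁻¹ * y := by
  refine le_of_abs_le (abs_le_of_sq_le_sq ?_ (by positivity))
  have h1 : (ε * a + ε⁻¹ * y) ^ 2 = a * y + ((ε * a) ^ 2 + (ε⁻¹ * y) ^ 2 + a * y) := by
    field_simp
    ring
  have h2 : 0 ≤ (ε * a) ^ 2 + (ε⁻¹ * y) ^ 2 + a * y := by positivity
  linarith

/-- The error terms produced by a cutoff `ζ` in the two energy identities are controlled by a
small multiple of `∫ ζ² (Δv)²` and a lower order term `∫ v² Θ`. -/
lemma exists_energy_error_bound {ε : ℝ} (hε : 0 < ε) : ∃ C : ℝ, 0 ≤ C ∧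
    ∀ v ζ W Θ : Euc n → ℝ, ContDiff ℝ 4 v → ContDiff ℝ 2 ζ → HasCompactSupport ζ →
      ContDiff ℝ 2 W → HasCompactSupport W → Continuous Θ → HasCompactSupport Θ →
      (∀ x, gradInner ζ ζ x ≤ W x) → (∀ x, lap ζ x ^ 2 ≤ Θ x) → (∀ x, |lap W x| ≤ Θ x) →
      (∀ x, W x ^ 2 ≤ ζ x ^ 2 * Θ x) →
      (∫ x, lap (fun y => v y * ζ y) x ^ 2) ≤ (∫ x, lap (lap v) x * (v x * ζ x ^ 2))
          + (ε * (∫ x, ζ x ^ 2 * lap v x ^ 2) + C * ∫ x, v x ^ 2 * Θ x) ∧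
      |(∫ x, lap (lap v) x * (v x * ζ x ^ 2)) - ∫ x, ζ x ^ 2 * lap v x ^ 2|
          ≤ ε * (∫ x, ζ x ^ 2 * lap v x ^ 2) + C * ∫ x, v x ^ 2 * Θ x := by
  set δ : ℝ := ε / 2 with hδ
  have hδ0 : 0 < δ := by positivity
  obtain ⟨η, hη0, hη1⟩ : ∃ η : ℝ, 0 < η ∧ (10 + 8 * δ⁻¹) * η ≤ δ :=
    ⟨δ / (10 + 8 * δ⁻¹), by positivity, by rw [mul_div_cancel₀]; positivity⟩
  refine ⟨(1 + δ⁻¹) * (6 + 10 * η⁻¹), by positivity, ?_⟩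
  intro v ζ W Θ hv hζ hζc hW hWc hΘ hΘc hζW hζΘ hWΘ hWζ
  have hv2 : ContDiff ℝ 2 v := hv.of_le (by norm_num)
  have hlv : ContDiff ℝ 2 (lap v) := hv.lap (by norm_num)
  have cv := hv.continuous
  have cl := hlv.continuous
  have cζ := hζ.continuous
  set P : Euc n → ℝ := fun x => 2 * gradInner v ζ x + v x * lap ζ x with hP
  have cP : Continuous P := (continuous_const.mul (hv2.continuous_gradInner hζ)).add
    (cv.mul hζ.continuous_lap)
  have hW0 : ∀ x, 0 ≤ W x := fun x => (gradInner_self_nonneg ζ x).trans (hζW x)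
  have hΘ0 : ∀ x, 0 ≤ Θ x := fun x => (sq_nonneg _).trans (hζΘ x)
  have hP0 : ∀ x ∉ tsupport ζ, P x = 0 := by
    intro x hx
    have h1 : ∀ i, partialDeriv i ζ x = 0 := fun i => by
      have h0 : fderiv ℝ ζ x = 0 := image_eq_zero_of_notMem_tsupport
        (fun h => hx (tsupport_fderiv_subset ℝ h))
      simp [partialDeriv, h0]
    simp [hP, gradInner, h1, lap_eq_zero_of_notMem_tsupport hx]
  have iA : Integrable fun x => ζ x ^ 2 * lap v x ^ 2 :=
    integrable_of_zero_off_tsupport ((cζ.pow 2).mul (cl.pow 2)) hζc fun x hx => by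
      simp [image_eq_zero_of_notMem_tsupport hx]
  have iY : Integrable fun x => v x ^ 2 * Θ x :=
    integrable_of_zero_off_tsupport ((cv.pow 2).mul hΘ) hΘc fun x hx => by
      simp [image_eq_zero_of_notMem_tsupport hx]
  have iX : Integrable fun x => |v x * lap v x * W x| :=
    integrable_of_zero_off_tsupport ((cv.mul cl).mul hW.continuous).abs hWc fun x hx => by
      simp [image_eq_zero_of_notMem_tsupport hx]
  have iG : Integrable fun x => gradInner v v x * W x :=
    integrable_of_zero_off_tsupport ((hv2.continuous_gradInner hv2).mul hW.continuous) hWc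
      fun x hx => by simp [image_eq_zero_of_notMem_tsupport hx]
  have iP : Integrable fun x => P x ^ 2 :=
    integrable_of_zero_off_tsupport (cP.pow 2) hζc fun x hx => by simp [hP0 x hx]
  set A := ∫ x, ζ x ^ 2 * lap v x ^ 2 with hA
  set Y := ∫ x, v x ^ 2 * Θ x with hY
  set X := ∫ x, |v x * lap v x * W x| with hX
  set G := ∫ x, gradInner v v x * W x with hG
  set Q := ∫ x, P x ^ 2 with hQ
  have hY0 : 0 ≤ Y := integral_nonneg fun x => mul_nonneg (sq_nonneg _) (hΘ0 x)
  have hA0 : 0 ≤ A := integral_nonneg fun x => by positivity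
  have hXle : X ≤ η * A + η⁻¹ * Y := by
    rw [hA, hY, ← integral_const_mul, ← integral_const_mul,
      ← integral_add (iA.const_mul _) (iY.const_mul _)]
    refine integral_mono iX ((iA.const_mul _).add (iY.const_mul _)) fun x => ?_
    refine le_mul_add_inv_mul hη0 (by positivity) (mul_nonneg (sq_nonneg _) (hΘ0 x)) ?_
    rw [sq_abs]
    nlinarith [mul_le_mul_of_nonneg_left (hWζ x) (by positivity : 0 ≤ (v x * lap v x) ^ 2)]
  have hGle : 2 * G ≤ Y + 2 * X := by
    have hgreen := integral_mul_lap_comm (hv2.mul hv2) hW hWc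
    have hlap : ∀ x, lap (fun y => v y * v y) x * W x
        = 2 * (v x * lap v x * W x) + 2 * (gradInner v v x * W x) := fun x => by
      rw [lap_mul hv2 hv2]
      ring
    have iX' : Integrable fun x => v x * lap v x * W x :=
      integrable_of_zero_off_tsupport ((cv.mul cl).mul hW.continuous) hWc fun x hx => by
        simp [image_eq_zero_of_notMem_tsupport hx]
    simp only [hlap] at hgreen
    rw [integral_add (iX'.const_mul _) (iG.const_mul _), integral_const_mul, integral_const_mul,
      ← hG] at hgreen
    have h1 : ∫ x, v x * v x * lap W x ≤ Y := by
      refine integral_mono (integrable_of_zero_off_tsupport ((cv.mul cv).mul hW.continuous_lap)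
        hWc fun x hx => by simp [lap_eq_zero_of_notMem_tsupport hx]) iY fun x => ?_
      change v x * v x * lap W x ≤ v x ^ 2 * Θ x
      rw [← pow_two]
      exact mul_le_mul_of_nonneg_left ((le_abs_self _).trans (hWΘ x)) (sq_nonneg _)
    have h2 : -X ≤ ∫ x, v x * lap v x * W x :=
      (abs_le.1 (abs_integral_le_integral_abs (f := fun x => v x * lap v x * W x))).1
    linarith
  have hQle : Q ≤ 8 * G + 2 * Y := by
    rw [hG, hY, ← integral_const_mul, ← integral_const_mul,
      ← integral_add (iG.const_mul _) (iY.const_mul _)]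
    refine integral_mono iP ((iG.const_mul _).add (iY.const_mul _)) fun x => ?_
    change P x ^ 2 ≤ 8 * (gradInner v v x * W x) + 2 * (v x ^ 2 * Θ x)
    have h1 : gradInner v ζ x ^ 2 ≤ gradInner v v x * W x := (gradInner_sq_le v ζ x).trans
      (mul_le_mul_of_nonneg_left (hζW x) (gradInner_self_nonneg v x))
    have h2 : (v x * lap ζ x) ^ 2 ≤ v x ^ 2 * Θ x := by
      rw [mul_pow]
      exact mul_le_mul_of_nonneg_left (hζΘ x) (sq_nonneg _)
    simp only [hP]
    nlinarith [sq_nonneg (2 * gradInner v ζ x - v x * lap ζ x)]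
  have hζ2 : ContDiff ℝ 2 fun x => v x * ζ x ^ 2 := hv2.mul (hζ.pow 2)
  have hζ2c : HasCompactSupport fun x => v x * ζ x ^ 2 :=
    HasCompactSupport.intro' hζc (isClosed_tsupport ζ) fun x hx => by
      simp [image_eq_zero_of_notMem_tsupport hx]
  have iB : Integrable fun x => lap v x * lap (fun y => v y * ζ y ^ 2) x :=
    integrable_of_zero_off_tsupport (cl.mul hζ2.continuous_lap) hζ2c fun x hx => by
      simp [lap_eq_zero_of_notMem_tsupport hx]
  have hB := integral_mul_lap_comm hlv hζ2 hζ2c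
  have hexp : ∀ x, lap v x * lap (fun y => v y * ζ y ^ 2) x
      = ζ x ^ 2 * lap v x ^ 2 + 2 * (ζ x * lap v x) * P x
        + 2 * (v x * lap v x * gradInner ζ ζ x) := by
    intro x
    rw [lap_mul hv2 (hζ.pow 2), gradInner_sq_right hζ, lap_pow hζ 0]
    simp only [hP]
    push_cast
    ring
  have hexp' : ∀ x, lap (fun y => v y * ζ y) x ^ 2
      = lap v x * lap (fun y => v y * ζ y ^ 2) x + P x ^ 2
        - 2 * (v x * lap v x * gradInner ζ ζ x) := by
    intro x
    rw [hexp, lap_mul hv2 hζ]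
    simp only [hP]
    ring
  have hgW : ∀ x, |v x * lap v x * gradInner ζ ζ x| ≤ |v x * lap v x * W x| := by
    intro x
    rw [abs_mul, abs_mul _ (W x), abs_of_nonneg (gradInner_self_nonneg ζ x),
      abs_of_nonneg (hW0 x)]
    exact mul_le_mul_of_nonneg_left (hζW x) (abs_nonneg _)
  have hE : ∫ x, lap (fun y => v y * ζ y) x ^ 2
      ≤ (∫ x, lap (lap v) x * (v x * ζ x ^ 2)) + Q + 2 * X := by
    have iBP : Integrable fun x => lap v x * lap (fun y => v y * ζ y ^ 2) x + P x ^ 2 := iB.add iP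
    rw [← hB, hQ, hX, ← integral_const_mul, ← integral_add iB iP,
      ← integral_add iBP (iX.const_mul _)]
    refine integral_mono (integrable_of_zero_off_tsupport
      ((hv2.mul hζ).continuous_lap.pow 2) hζc fun x hx => ?_)
      (iBP.add (iX.const_mul _)) fun x => ?_
    · rw [lap_eq_zero_of_notMem_tsupport fun h => hx (tsupport_mul_subset_right h)]
      simp
    · change lap (fun y => v y * ζ y) x ^ 2 ≤ lap v x * lap (fun y => v y * ζ y ^ 2) x + P x ^ 2
        + 2 * |v x * lap v x * W x|
      rw [hexp']
      linarith [(abs_le.1 (hgW x)).1]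
  have hF : |(∫ x, lap (lap v) x * (v x * ζ x ^ 2)) - A| ≤ δ * A + δ⁻¹ * Q + 2 * X := by
    have iAP : Integrable fun x => δ * (ζ x ^ 2 * lap v x ^ 2) + δ⁻¹ * P x ^ 2 :=
      (iA.const_mul _).add (iP.const_mul _)
    rw [← hB, hA, ← integral_sub iB iA]
    refine abs_integral_le_integral_abs.trans ?_
    rw [hQ, hX, ← integral_const_mul, ← integral_const_mul, ← integral_const_mul,
      ← integral_add (iA.const_mul _) (iP.const_mul _),
      ← integral_add iAP (iX.const_mul _)]
    refine integral_mono (iB.sub iA).abs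
      (iAP.add (iX.const_mul _)) fun x => ?_
    change |lap v x * lap (fun y => v y * ζ y ^ 2) x - ζ x ^ 2 * lap v x ^ 2|
      ≤ δ * (ζ x ^ 2 * lap v x ^ 2) + δ⁻¹ * P x ^ 2 + 2 * |v x * lap v x * W x|
    have h1 : |2 * (ζ x * lap v x) * P x| ≤ δ * (ζ x ^ 2 * lap v x ^ 2) + δ⁻¹ * P x ^ 2 := by
      have h3 : δ * (ζ x ^ 2 * lap v x ^ 2) + δ⁻¹ * P x ^ 2 - 2 * (ζ x * lap v x) * P x
          = δ⁻¹ * (δ * (ζ x * lap v x) - P x) ^ 2 := by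
        field_simp
        ring
      have h4 : δ * (ζ x ^ 2 * lap v x ^ 2) + δ⁻¹ * P x ^ 2 + 2 * (ζ x * lap v x) * P x
          = δ⁻¹ * (δ * (ζ x * lap v x) + P x) ^ 2 := by
        field_simp
        ring
      have h5 : 0 ≤ δ⁻¹ * (δ * (ζ x * lap v x) - P x) ^ 2 := by positivity
      have h6 : 0 ≤ δ⁻¹ * (δ * (ζ x * lap v x) + P x) ^ 2 := by positivity
      exact abs_le.2 ⟨by linarith, by linarith⟩
    rw [hexp, show ∀ a b c : ℝ, a + b + c - a = b + c by intros; ring]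
    refine (abs_add_le _ _).trans (add_le_add h1 ?_)
    rw [abs_mul 2, abs_two]
    exact mul_le_mul_of_nonneg_left (hgW x) zero_le_two
  have hQ' : Q ≤ 6 * Y + 8 * X := by linarith
  have hd : 0 < δ⁻¹ := by positivity
  have he : 0 < η⁻¹ := by positivity
  have hηA : (10 + 8 * δ⁻¹) * η * A ≤ δ * A := mul_le_mul_of_nonneg_right hη1 hA0
  constructor
  · refine hE.trans ?_
    have h7 : 0 ≤ δ⁻¹ * η * A := by positivity
    have h8 : 0 ≤ δ⁻¹ * (6 + 10 * η⁻¹) * Y := by positivity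
    have h9 : 0 ≤ δ * A := by positivity
    have : ε = δ + δ := by rw [hδ]; ring
    rw [this]
    nlinarith
  · refine hF.trans ?_
    have h7 : δ⁻¹ * Q ≤ δ⁻¹ * (6 * Y + 8 * (η * A + η⁻¹ * Y)) := by gcongr; linarith
    have h8 : 0 ≤ η * A := by positivity
    have h9 : 0 ≤ η⁻¹ * Y := by positivity
    have h10 : 0 ≤ δ⁻¹ * (η⁻¹ * Y) := by positivity
    have : ε = δ + δ := by rw [hδ]; ring
    rw [this]
    nlinarith

end EnergyEstimates

/-! ### Scaled cutoff functions -/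

section Cutoff

variable {n : ℕ}

lemma abs_lap_pow_le {η : Euc n → ℝ} (hη : ContDiff ℝ 2 η) {x : Euc n} (h0 : 0 ≤ η x)
    (h1 : η x ≤ 1) {s : ℝ} (hl : |lap η x| ≤ s) (hg : gradInner η η x ≤ s) (k : ℕ) :
    |lap (fun y => η y ^ (k + 2)) x| ≤ (k + 2) ^ 2 * s * η x ^ k := by
  have hs : 0 ≤ s := (abs_nonneg _).trans hl
  have hpow : η x ^ (k + 1) ≤ η x ^ k := pow_le_pow_of_le_one h0 h1 (Nat.le_succ k)
  have hk : 0 ≤ η x ^ k := by positivity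
  rw [lap_pow hη]
  have e1 : |(k + 2) * η x ^ (k + 1) * lap η x| ≤ (k + 2) * η x ^ k * s := by
    rw [abs_mul, abs_of_nonneg (by positivity)]
    gcongr
  have e2 : |(k + 2) * (k + 1) * η x ^ k * gradInner η η x| ≤ (k + 2) * (k + 1) * η x ^ k * s := by
    rw [abs_of_nonneg (mul_nonneg (by positivity) (gradInner_self_nonneg _ _))]
    gcongr
  calc _ ≤ (k + 2) * η x ^ k * s + (k + 2) * (k + 1) * η x ^ k * s :=
        (abs_add_le _ _).trans (add_le_add e1 e2)
    _ = _ := by ring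

/-- The standard smooth cutoff, equal to `1` on the unit ball and `0` off the ball of radius `2`. -/
def unitCutoff (n : ℕ) : ContDiffBump (0 : Euc n) := ⟨1, 2, one_pos, one_lt_two⟩

/-- The standard cutoff at scale `R`. -/
def scaledCutoff (n : ℕ) (R : ℝ) (x : Euc n) : ℝ := unitCutoff n (R⁻¹ • x)

lemma contDiff_scaledCutoff (R : ℝ) {k : ℕ∞} : ContDiff ℝ k (scaledCutoff n R) :=
  (unitCutoff n).contDiff.comp (contDiff_const_smul _)

lemma scaledCutoff_nonneg (R : ℝ) (x : Euc n) : 0 ≤ scaledCutoff n R x := (unitCutoff n).nonneg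

lemma scaledCutoff_le_one (R : ℝ) (x : Euc n) : scaledCutoff n R x ≤ 1 := (unitCutoff n).le_one

lemma scaledCutoff_eq_one {R : ℝ} (hR : 0 < R) {x : Euc n} (hx : ‖x‖ ≤ R) :
    scaledCutoff n R x = 1 := by
  refine (unitCutoff n).one_of_mem_closedBall ?_
  change R⁻¹ • x ∈ closedBall 0 1
  rw [mem_closedBall_zero_iff, norm_smul, norm_inv, Real.norm_of_nonneg hR.le,
    inv_mul_le_iff₀ hR, mul_one]
  exact hx

lemma scaledCutoff_eq_zero {R : ℝ} (hR : 0 < R) {x : Euc n} (hx : x ∉ ball (0 : Euc n) (2 * R)) :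
    scaledCutoff n R x = 0 := by
  refine (unitCutoff n).zero_of_le_dist ?_
  change 2 ≤ dist (R⁻¹ • x) 0
  rw [mem_ball_zero_iff, not_lt] at hx
  rw [dist_zero_right, norm_smul, norm_inv, Real.norm_of_nonneg hR.le, le_inv_mul_iff₀ hR,
    mul_comm]
  exact hx

lemma hasCompactSupport_scaledCutoff {R : ℝ} (hR : 0 < R) :
    HasCompactSupport (scaledCutoff n R) :=
  HasCompactSupport.intro (isCompact_closedBall (0 : Euc n) (2 * R)) fun _ hx =>
    scaledCutoff_eq_zero hR fun h => hx (ball_subset_closedBall h)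

lemma exists_scaledCutoff_bound (n : ℕ) : ∃ M : ℝ, 0 ≤ M ∧ ∀ (R : ℝ) (x : Euc n),
    gradInner (scaledCutoff n R) (scaledCutoff n R) x ≤ M * R⁻¹ ^ 2 ∧
      |lap (scaledCutoff n R) x| ≤ M * R⁻¹ ^ 2 := by
  have hχ : ContDiff ℝ 2 (unitCutoff n) := (unitCutoff n).contDiff
  have hχc : HasCompactSupport (unitCutoff n) := (unitCutoff n).hasCompactSupport
  obtain ⟨M₁, hM₁⟩ := hχc.gradInner_right.exists_bound_of_continuous (hχ.continuous_gradInner hχ)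
  obtain ⟨M₂, hM₂⟩ := hχc.lap.exists_bound_of_continuous hχ.continuous_lap
  refine ⟨max M₁ M₂, (norm_nonneg _).trans ((hM₁ 0).trans (le_max_left _ _)), fun R x => ⟨?_, ?_⟩⟩
  · have := gradInner_comp_smul R⁻¹ (unitCutoff n) x
    rw [show scaledCutoff n R = fun y => unitCutoff n (R⁻¹ • y) from rfl, this, mul_comm]
    gcongr
    exact (le_abs_self _).trans ((hM₁ _).trans (le_max_left _ _))
  · have := lap_comp_smul R⁻¹ hχ x
    rw [show scaledCutoff n R = fun y => unitCutoff n (R⁻¹ • y) from rfl, this, abs_mul,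
      abs_of_nonneg (sq_nonneg _), mul_comm]
    gcongr
    exact (hM₂ _).trans (le_max_right _ _)

end Cutoff

/-! ### Young's inequality in the critical case -/

section Young

lemma exists_young_const {q q' : ℝ} (hq : q.HolderConjugate q') {δ : ℝ} (hδ : 0 < δ) :
    ∃ C : ℝ, 0 ≤ C ∧ ∀ a b : ℝ, 0 ≤ a → 0 ≤ b → a * b ≤ δ * a ^ q + C * b ^ q' := by
  have hq0 : 0 < q := hq.pos
  have hq0' : 0 < q' := hq.symm.pos
  set l := δ ^ q⁻¹ with hl
  have hl0 : 0 < l := rpow_pos_of_pos hδ _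
  have hlq : l ^ q = δ := by rw [hl, ← rpow_mul hδ.le, inv_mul_cancel₀ hq0.ne', rpow_one]
  refine ⟨l⁻¹ ^ q', by positivity, fun a b ha hb => ?_⟩
  have h := Real.young_inequality_of_nonneg (mul_nonneg hl0.le ha)
    (mul_nonneg (inv_nonneg.2 hl0.le) hb) hq
  rw [mul_rpow hl0.le ha, mul_rpow (inv_nonneg.2 hl0.le) hb, hlq] at h
  calc a * b = l * a * (l⁻¹ * b) := by field_simp
    _ ≤ _ := h
    _ ≤ _ := add_le_add (div_le_self (by positivity) hq.lt.le)
      (div_le_self (by positivity) hq.symm.lt.le)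

variable {n : ℕ} {p : ℝ}

lemma holderConjugate_critical (hn : 5 ≤ n) :
    ((n : ℝ) / (n - 4)).HolderConjugate ((n : ℝ) / 4) := by
  have : (5 : ℝ) ≤ n := by exact_mod_cast hn
  have h4 : (0 : ℝ) < n - 4 := by linarith
  rw [Real.holderConjugate_iff]
  refine ⟨(one_lt_div h4).2 (by linarith), ?_⟩
  field_simp
  ring

lemma rpow_critical_bounds (hn : 5 ≤ n) (hp : p = ((n : ℝ) + 4) / ((n : ℝ) - 4)) {t e r : ℝ}
    (ht : 0 ≤ t) (he0 : 0 ≤ e) (he1 : e ≤ 1) (hr : 0 ≤ r) :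
    (t ^ 2 * e ^ (2 * n)) ^ ((n : ℝ) / (n - 4)) ≤ t ^ (p + 1) * (e ^ (n + 2)) ^ 2 ∧
      (r ^ 4) ^ ((n : ℝ) / 4) = r ^ n := by
  have h5 : (5 : ℝ) ≤ n := by exact_mod_cast hn
  have h4 : (0 : ℝ) < n - 4 := by linarith
  constructor
  · rw [mul_rpow (by positivity) (by positivity), ← rpow_natCast t, ← rpow_mul ht]
    have h1 : ((2 : ℕ) : ℝ) * (n / (n - 4)) = p + 1 := by
      rw [hp]
      push_cast
      field_simp
      ring
    rw [h1]
    refine mul_le_mul_of_nonneg_left ?_ (by positivity)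
    rcases he0.eq_or_lt with rfl | he
    · rw [zero_pow (by omega), zero_rpow (by positivity)]
      positivity
    · rw [← pow_mul, ← rpow_natCast, ← rpow_natCast, ← rpow_mul he0]
      refine rpow_le_rpow_of_exponent_ge he he1 ?_
      push_cast
      rw [← mul_div_assoc, le_div_iff₀ h4]
      nlinarith
  · rw [← rpow_natCast, ← rpow_mul hr, ← rpow_natCast]
    congr 1
    push_cast
    ring

lemma exists_critical_young_left (hn : 5 ≤ n) (hp : p = ((n : ℝ) + 4) / ((n : ℝ) - 4))
    {δ : ℝ} (hδ : 0 < δ) : ∃ C : ℝ, 0 ≤ C ∧ ∀ t e r : ℝ, 0 ≤ t → 0 ≤ e → e ≤ 1 → 0 ≤ r →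
      t ^ 2 * (r ^ 4 * e ^ (2 * n)) ≤ δ * (t ^ (p + 1) * (e ^ (n + 2)) ^ 2) + C * r ^ n := by
  obtain ⟨C, hC, h⟩ := exists_young_const (holderConjugate_critical hn) hδ
  refine ⟨C, hC, fun t e r ht he0 he1 hr => ?_⟩
  obtain ⟨h1, h2⟩ := rpow_critical_bounds hn hp ht he0 he1 hr
  have := h (t ^ 2 * e ^ (2 * n)) (r ^ 4) (by positivity) (by positivity)
  rw [h2] at this
  calc t ^ 2 * (r ^ 4 * e ^ (2 * n)) = t ^ 2 * e ^ (2 * n) * r ^ 4 := by ring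
    _ ≤ _ := this
    _ ≤ _ := by gcongr

lemma exists_critical_young_right (hn : 5 ≤ n) (hp : p = ((n : ℝ) + 4) / ((n : ℝ) - 4))
    {δ : ℝ} (hδ : 0 < δ) : ∃ C : ℝ, 0 ≤ C ∧ ∀ t e r : ℝ, 0 ≤ t → 0 ≤ e → e ≤ 1 → 0 ≤ r →
      t ^ 2 * (r ^ 4 * e ^ (2 * n)) ≤ C * (t ^ (p + 1) * (e ^ (n + 2)) ^ 2) + δ * r ^ n := by
  obtain ⟨C, hC, h⟩ := exists_young_const (holderConjugate_critical hn).symm hδ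
  refine ⟨C, hC, fun t e r ht he0 he1 hr => ?_⟩
  obtain ⟨h1, h2⟩ := rpow_critical_bounds hn hp ht he0 he1 hr
  have := h (r ^ 4) (t ^ 2 * e ^ (2 * n)) (by positivity) (by positivity)
  rw [h2] at this
  calc t ^ 2 * (r ^ 4 * e ^ (2 * n)) = r ^ 4 * (t ^ 2 * e ^ (2 * n)) := by ring
    _ ≤ _ := this
    _ = C * (t ^ 2 * e ^ (2 * n)) ^ ((n : ℝ) / (n - 4)) + δ * r ^ n := by ring
    _ ≤ _ := by gcongr

end Young

/-! ### Energy estimates at scale `R` -/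

section ScaledEnergy

variable {n m : ℕ} {p : ℝ} {u : Euc n → EuclideanSpace ℝ (Fin m)}

lemma exists_scaled_energy_error_bound {ε : ℝ} (hε : 0 < ε) (hn : 1 ≤ n) :
    ∃ C : ℝ, 0 ≤ C ∧ ∀ R : ℝ, 0 < R → ∀ v : Euc n → ℝ, ContDiff ℝ 4 v →
      (∫ x, lap (fun y => v y * scaledCutoff n R y ^ (n + 2)) x ^ 2)
        ≤ (∫ x, lap (lap v) x * (v x * (scaledCutoff n R x ^ (n + 2)) ^ 2))
          + (ε * (∫ x, (scaledCutoff n R x ^ (n + 2)) ^ 2 * lap v x ^ 2)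
            + C * ∫ x, v x ^ 2 * (R⁻¹ ^ 4 * scaledCutoff n R x ^ (2 * n))) ∧
      |(∫ x, lap (lap v) x * (v x * (scaledCutoff n R x ^ (n + 2)) ^ 2))
          - ∫ x, (scaledCutoff n R x ^ (n + 2)) ^ 2 * lap v x ^ 2|
        ≤ ε * (∫ x, (scaledCutoff n R x ^ (n + 2)) ^ 2 * lap v x ^ 2)
          + C * ∫ x, v x ^ 2 * (R⁻¹ ^ 4 * scaledCutoff n R x ^ (2 * n)) := by
  obtain ⟨C, hC, h⟩ := exists_energy_error_bound (n := n) hε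
  obtain ⟨M, hM, hb⟩ := exists_scaledCutoff_bound n
  refine ⟨C * (4 * (n + 2) ^ 4 * M ^ 2), by positivity, fun R hR v hv => ?_⟩
  set η := scaledCutoff n R with hη
  have η2 : ContDiff ℝ 2 η := contDiff_scaledCutoff (k := 2) R
  have ηc : HasCompactSupport η := hasCompactSupport_scaledCutoff hR
  have η0 : ∀ x, 0 ≤ η x := scaledCutoff_nonneg R
  have η1 : ∀ x, η x ≤ 1 := scaledCutoff_le_one R
  have hpowc : ∀ k, 0 < k → HasCompactSupport fun x => η x ^ k := fun k hk =>
    ηc.comp_left (g := fun t : ℝ => t ^ k) (zero_pow hk.ne')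
  set s := M * R⁻¹ ^ 2 with hs
  have hs0 : 0 ≤ s := by positivity
  let ζ : Euc n → ℝ := fun x => η x ^ (n + 2)
  let W : Euc n → ℝ := fun x => (n + 2) ^ 2 * s * η x ^ (2 * n + 2)
  let Θ : Euc n → ℝ := fun x => 4 * (n + 2) ^ 4 * M ^ 2 * (R⁻¹ ^ 4 * η x ^ (2 * n))
  have hg : ∀ x, gradInner ζ ζ x ≤ W x := by
    intro x
    rw [gradInner_pow η2 (n + 1)]
    calc _ = (n + 2) ^ 2 * η x ^ (2 * n + 2) * gradInner η η x := by push_cast; ring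
      _ ≤ (n + 2) ^ 2 * η x ^ (2 * n + 2) * s :=
        mul_le_mul_of_nonneg_left (hb R x).1 (mul_nonneg (by positivity) (pow_nonneg (η0 x) _))
      _ = _ := by ring
  have hl : ∀ x, lap ζ x ^ 2 ≤ Θ x := by
    intro x
    have h1 := abs_lap_pow_le η2 (η0 x) (η1 x) (hb R x).2 (hb R x).1 n
    calc _ = |lap (fun y => η y ^ (n + 2)) x| ^ 2 := (sq_abs _).symm
      _ ≤ ((n + 2) ^ 2 * s * η x ^ n) ^ 2 := by gcongr
      _ = (n + 2) ^ 4 * M ^ 2 * (R⁻¹ ^ 4 * η x ^ (2 * n)) := by rw [hs]; ring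
      _ ≤ _ := by
        have : 0 ≤ (n + 2) ^ 4 * M ^ 2 * (R⁻¹ ^ 4 * η x ^ (2 * n)) :=
          mul_nonneg (by positivity) (mul_nonneg (by positivity) (pow_nonneg (η0 x) _))
        linarith
  have hW : ∀ x, |lap W x| ≤ Θ x := by
    intro x
    have h1 := abs_lap_pow_le η2 (η0 x) (η1 x) (hb R x).2 (hb R x).1 (2 * n)
    rw [lap_const_mul _ (η2.pow _), abs_mul, abs_of_nonneg (by positivity)]
    have hk : 0 ≤ η x ^ (2 * n) := pow_nonneg (η0 x) _
    calc _ ≤ (n + 2) ^ 2 * s * (((2 * n : ℕ) + 2) ^ 2 * s * η x ^ (2 * n)) := by gcongr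
      _ = 4 * (n + 2) ^ 2 * (n + 1) ^ 2 * M ^ 2 * (R⁻¹ ^ 4 * η x ^ (2 * n)) := by
        rw [hs]; push_cast; ring
      _ ≤ 4 * (n + 2) ^ 2 * (n + 2) ^ 2 * M ^ 2 * (R⁻¹ ^ 4 * η x ^ (2 * n)) := by
        gcongr
        linarith
      _ = _ := by ring
  have hWζ : ∀ x, W x ^ 2 ≤ ζ x ^ 2 * Θ x := by
    intro x
    change ((n + 2) ^ 2 * s * η x ^ (2 * n + 2)) ^ 2 ≤ (η x ^ (n + 2)) ^ 2
      * (4 * (n + 2) ^ 4 * M ^ 2 * (R⁻¹ ^ 4 * η x ^ (2 * n)))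
    have : 0 ≤ (n + 2) ^ 4 * M ^ 2 * R⁻¹ ^ 4 * η x ^ (4 * n + 4) :=
      mul_nonneg (by positivity) (pow_nonneg (η0 x) _)
    calc _ = (n + 2) ^ 4 * M ^ 2 * R⁻¹ ^ 4 * η x ^ (4 * n + 4) := by rw [hs]; ring
      _ ≤ 4 * ((n + 2) ^ 4 * M ^ 2 * R⁻¹ ^ 4 * η x ^ (4 * n + 4)) := by linarith
      _ = _ := by ring
  have key := h v ζ W Θ hv (η2.pow _) (hpowc _ (by omega))
    (contDiff_const.mul (η2.pow _)) (hpowc _ (by omega)).mul_left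
    (continuous_const.mul (continuous_const.mul (η2.continuous.pow _)))
    (hpowc (2 * n) (by omega)).mul_left.mul_left hg hl hW hWζ
  have e : ∀ x, v x ^ 2 * Θ x
      = (4 * (n + 2) ^ 4 * M ^ 2) * (v x ^ 2 * (R⁻¹ ^ 4 * η x ^ (2 * n))) := fun x => by
    simp only [Θ]
    ring
  simp only [e, integral_const_mul] at key
  rw [mul_assoc C]
  exact key

/-- The cut-off bending energy of `u` at scale `R`. -/
def cutoffBending (u : Euc n → EuclideanSpace ℝ (Fin m)) (R : ℝ) : ℝ :=
  ∑ i, ∫ x, (scaledCutoff n R x ^ (n + 2)) ^ 2 * lap (fun y => u y i) x ^ 2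

/-- The cut-off potential energy of `u` at scale `R`. -/
def cutoffPotential (p : ℝ) (u : Euc n → EuclideanSpace ℝ (Fin m)) (R : ℝ) : ℝ :=
  ∫ x, ‖u x‖ ^ (p + 1) * (scaledCutoff n R x ^ (n + 2)) ^ 2

/-- The lower order error produced by the cutoff at scale `R`. -/
def cutoffError (u : Euc n → EuclideanSpace ℝ (Fin m)) (R : ℝ) : ℝ :=
  ∫ x, ‖u x‖ ^ 2 * (R⁻¹ ^ 4 * scaledCutoff n R x ^ (2 * n))

lemma cutoffBending_nonneg (R : ℝ) : 0 ≤ cutoffBending u R :=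
  Finset.sum_nonneg fun _ _ => integral_nonneg fun _ => by positivity

lemma cutoffPotential_nonneg (R : ℝ) : 0 ≤ cutoffPotential p u R :=
  integral_nonneg fun _ => by positivity

lemma cutoffError_nonneg (R : ℝ) : 0 ≤ cutoffError u R :=
  integral_nonneg fun x => mul_nonneg (sq_nonneg _)
    (mul_nonneg (by positivity) (pow_nonneg (scaledCutoff_nonneg R x) _))

lemma continuous_scaledCutoff (R : ℝ) : Continuous (scaledCutoff n R) :=
  (contDiff_scaledCutoff (k := 0) R).continuous

lemma integrable_mul_scaledCutoff_pow {f : Euc n → ℝ} (hf : Continuous f) {R : ℝ} (hR : 0 < R)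
    {k : ℕ} (hk : k ≠ 0) : Integrable fun x => f x * scaledCutoff n R x ^ k :=
  integrable_of_zero_off_tsupport (hf.mul ((continuous_scaledCutoff R).pow k))
    (hasCompactSupport_scaledCutoff hR) fun x hx => by
      simp [image_eq_zero_of_notMem_tsupport hx, hk]

lemma exists_cutoff_estimates {ε : ℝ} (hε : 0 < ε) (hn : 1 ≤ n) (hp : 1 < p)
    (hu : ContDiff ℝ 4 u)
    (hsol : ∀ i x, lap (fun z => lap (fun w => u w i) z) x = ‖u x‖ ^ (p - 1) * u x i) :
    ∃ C : ℝ, 0 ≤ C ∧ ∀ R : ℝ, 0 < R →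
      (∑ i, ∫ x, lap (fun y => u y i * scaledCutoff n R y ^ (n + 2)) x ^ 2)
        ≤ cutoffPotential p u R + (ε * cutoffBending u R + C * cutoffError u R) ∧
      |cutoffPotential p u R - cutoffBending u R|
        ≤ ε * cutoffBending u R + C * cutoffError u R := by
  obtain ⟨C, hC, h⟩ := exists_scaled_energy_error_bound (n := n) hε hn
  refine ⟨C, hC, fun R hR => ?_⟩
  have hui := fun i => (hu.euclidean_coord i).continuous
  have hη := continuous_scaledCutoff (n := n) R
  have hsq : ∀ x, ∑ i, u x i ^ 2 = ‖u x‖ ^ 2 := fun x => (EuclideanSpace.real_norm_sq_eq _).symm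
  have hpow : ∀ x, ‖u x‖ ^ (p - 1) * ‖u x‖ ^ 2 = ‖u x‖ ^ (p + 1) := fun x => by
    rcases eq_or_ne (u x) 0 with h0 | h0
    · simp [h0, zero_rpow (by linarith : p + 1 ≠ 0)]
    · rw [← rpow_natCast, ← rpow_add (norm_pos_iff.2 h0)]
      norm_num
      ring_nf
  have hB : cutoffPotential p u R = ∑ i, ∫ x, lap (lap fun w => u w i) x
      * (u x i * (scaledCutoff n R x ^ (n + 2)) ^ 2) := by
    rw [← integral_finsetSum, cutoffPotential]
    · congr 1
      funext x
      rw [← hpow, ← hsq, Finset.mul_sum, Finset.sum_mul]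
      refine Finset.sum_congr rfl fun i _ => ?_
      have := hsol i x
      rw [show lap (lap fun w => u w i) x = _ from this]
      ring
    · intro i _
      have := integrable_mul_scaledCutoff_pow
        (f := fun x => lap (lap fun w => u w i) x * u x i)
        (((hu.euclidean_coord i).lap (k := 2) (by norm_num)).continuous_lap.mul (hui i)) hR
        (k := (n + 2) * 2) (by omega)
      simpa only [pow_mul, mul_assoc] using this
  have hY : cutoffError u R
      = ∑ i, ∫ x, u x i ^ 2 * (R⁻¹ ^ 4 * scaledCutoff n R x ^ (2 * n)) := by
    rw [← integral_finsetSum, cutoffError]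
    · simp only [← hsq, Finset.sum_mul]
    · intro i _
      convert (integrable_mul_scaledCutoff_pow ((hui i).pow 2) hR
        (k := 2 * n) (by omega)).const_mul (R⁻¹ ^ 4) using 2
      simp only [Pi.pow_apply]
      ring
  rw [hB, hY, cutoffBending, Finset.mul_sum, Finset.mul_sum, ← Finset.sum_add_distrib,
    ← Finset.sum_add_distrib, ← Finset.sum_sub_distrib]
  exact ⟨Finset.sum_le_sum fun i _ => (h R hR _ (hu.euclidean_coord i)).1,
    (Finset.abs_sum_le_sum_abs _ _).trans
      (Finset.sum_le_sum fun i _ => (h R hR _ (hu.euclidean_coord i)).2)⟩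

lemma inv_pow_mul_volume_ball {R : ℝ} (hR : 0 < R) :
    R⁻¹ ^ n * volume.real (ball (0 : Euc n) (2 * R))
      = 2 ^ n * volume.real (ball (0 : Euc n) 1) := by
  rw [measureReal_def, Measure.addHaar_ball_of_pos _ _ (by positivity : 0 < 2 * R),
    ENNReal.toReal_mul, ENNReal.toReal_ofReal (by positivity), finrank_euclideanSpace_fin, mul_pow,
    measureReal_def]
  rw [mul_comm (2 ^ n) (R ^ n), mul_assoc, ← mul_assoc, ← mul_pow, inv_mul_cancel₀ hR.ne', one_pow,
    one_mul]

lemma integrable_indicator_ball (c r : ℝ) :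
    Integrable ((ball (0 : Euc n) r).indicator fun _ => c) :=
  (integrable_indicator_iff measurableSet_ball).2 (integrableOn_const measure_ball_lt_top.ne)

lemma exists_cutoffError_le (hn : 5 ≤ n) (hp : p = ((n : ℝ) + 4) / ((n : ℝ) - 4)) (hp1 : 1 < p)
    (hu : Continuous u) {δ : ℝ} (hδ : 0 < δ) :
    ∃ C : ℝ, ∀ R : ℝ, 0 < R → cutoffError u R ≤ δ * cutoffPotential p u R + C := by
  obtain ⟨C, hC, h⟩ := exists_critical_young_left hn hp hδ
  refine ⟨C * (2 ^ n * volume.real (ball (0 : Euc n) 1)), fun R hR => ?_⟩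
  have iB : Integrable fun x => ‖u x‖ ^ (p + 1) * (scaledCutoff n R x ^ (n + 2)) ^ 2 := by
    simpa only [pow_mul] using integrable_mul_scaledCutoff_pow
      (hu.norm.rpow_const fun x => .inr (by linarith : 0 ≤ p + 1)) hR
      (k := (n + 2) * 2) (by omega)
  have iY : Integrable fun x => ‖u x‖ ^ 2 * (R⁻¹ ^ 4 * scaledCutoff n R x ^ (2 * n)) := by
    convert (integrable_mul_scaledCutoff_pow (hu.norm.pow 2) hR
      (k := 2 * n) (by omega)).const_mul (R⁻¹ ^ 4) using 2
    simp only [Pi.pow_apply]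
    ring
  have e : C * (2 ^ n * volume.real (ball (0 : Euc n) 1))
      = ∫ x, (ball (0 : Euc n) (2 * R)).indicator (fun _ => C * R⁻¹ ^ n) x := by
    rw [integral_indicator_const _ measurableSet_ball, smul_eq_mul, ← inv_pow_mul_volume_ball hR]
    ring
  rw [e, cutoffError, cutoffPotential, ← integral_const_mul,
    ← integral_add (iB.const_mul _) (integrable_indicator_ball _ _)]
  refine integral_mono iY ((iB.const_mul _).add (integrable_indicator_ball _ _)) fun x => ?_
  change _ ≤ δ * _ + _
  by_cases hx : x ∈ ball (0 : Euc n) (2 * R)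
  · rw [indicator_of_mem hx]
    exact h _ _ _ (norm_nonneg _) (scaledCutoff_nonneg R x) (scaledCutoff_le_one R x)
      (by positivity)
  · rw [indicator_of_notMem hx, scaledCutoff_eq_zero hR hx]
    simp [show 2 * n ≠ 0 by omega]

lemma exists_cutoff_energy_bound (hn : 5 ≤ n) (hp : p = ((n : ℝ) + 4) / ((n : ℝ) - 4))
    (hp1 : 1 < p) (hu : ContDiff ℝ 4 u)
    (hsol : ∀ i x, lap (fun z => lap (fun w => u w i) z) x = ‖u x‖ ^ (p - 1) * u x i)
    {R₀ : ℝ} (hR₀ : 0 < R₀) (hst : Stable2 n m p u (closure (ball (0 : Euc n) R₀))ᶜ) :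
    ∃ K R₁ : ℝ, 0 < R₁ ∧ ∀ R, R₁ ≤ R → cutoffPotential p u R ≤ K ∧ cutoffBending u R ≤ K := by
  have hu2 : ContDiff ℝ 2 u := hu.of_le (by norm_num)
  obtain ⟨C₀, R₁, hC₀⟩ := hst.exists_const hR₀ hp1 hu2
  set ε : ℝ := min (1 / 2) ((p - 1) / 12) with hε
  have hε0 : 0 < ε := lt_min (by norm_num) (by linarith)
  have hε1 : ε ≤ 1 / 2 := min_le_left _ _
  have hε2 : ε ≤ (p - 1) / 12 := min_le_right _ _
  obtain ⟨C, hC, hE⟩ := exists_cutoff_estimates hε0 (by omega) hp1 hu hsol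
  set δ : ℝ := (p - 1) / (12 * (C + 1)) with hδ
  have hδ0 : 0 < δ := div_pos (by linarith) (by positivity)
  have hδC : C * δ ≤ (p - 1) / 12 := by
    rw [hδ, mul_div_assoc', div_le_div_iff₀ (by positivity) (by norm_num)]
    nlinarith
  obtain ⟨D, hD⟩ := exists_cutoffError_le hn hp hp1 hu.continuous hδ0
  refine ⟨max (2 * (2 * (C * D) + C₀) / (p - 1))
    (2 * (2 * (2 * (C * D) + C₀) / (p - 1)) + (2 * (2 * (C * D) + C₀) + 2 * (C * D))),
    max R₁ 1, by positivity, fun R hR => ?_⟩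
  have hR0 : 0 < R := lt_of_lt_of_le (by positivity) hR
  obtain ⟨h1, h2⟩ := hE R hR0
  have h3 := hD R hR0
  have h4 := hC₀ (fun x => scaledCutoff n R x ^ (n + 2))
    ((contDiff_scaledCutoff (k := 2) R).pow _)
    ((hasCompactSupport_scaledCutoff hR0).comp_left (g := fun t : ℝ => t ^ (n + 2)) (by simp))
    fun x hx => by
      rw [scaledCutoff_eq_one hR0 ((mem_ball_zero_iff.1 hx).le.trans
        ((le_max_left _ _).trans hR)), one_pow]
  change p * cutoffPotential p u R ≤ _ at h4
  have hA := cutoffBending_nonneg (u := u) R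
  have hB := cutoffPotential_nonneg (p := p) (u := u) R
  have hY := cutoffError_nonneg (u := u) R
  have h5 := (abs_le.1 h2).1
  set A := cutoffBending u R
  set B := cutoffPotential p u R
  set Y := cutoffError u R
  have h6 : C * Y ≤ (p - 1) / 12 * B + C * D := by nlinarith
  have h7 : ε * A ≤ 1 / 2 * A := by gcongr
  have h8 : A ≤ 2 * B + 2 * (C * Y) := by linarith
  have h9 : (p - 1) * B ≤ ε * A + C * Y + C₀ := by linarith
  have h10 : ε * A ≤ (p - 1) / 12 * (2 * B) + C * Y := by
    have : ε * A ≤ ε * (2 * B + 2 * (C * Y)) := by gcongr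
    nlinarith [mul_nonneg hC hY]
  have h11 : (p - 1) * B ≤ 2 * (2 * (C * D) + C₀) := by nlinarith
  have h12 : B ≤ 2 * (2 * (C * D) + C₀) / (p - 1) := by
    rw [le_div_iff₀ (by linarith)]
    linarith
  have h13 : A ≤ 2 * (2 * (2 * (C * D) + C₀) / (p - 1))
      + (2 * (2 * (C * D) + C₀) + 2 * (C * D)) := by
    nlinarith
  exact ⟨h12.trans (le_max_left _ _), h13.trans (le_max_right _ _)⟩

end ScaledEnergy

/-! ### Passage to the limit `R → ∞` -/

section Limit

variable {n m : ℕ} {p : ℝ} {u : Euc n → EuclideanSpace ℝ (Fin m)}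

lemma integrable_of_cutoff_bound {f : Euc n → ℝ} (hf : Continuous f) (hf0 : ∀ x, 0 ≤ f x)
    {K R₁ : ℝ} (hR₁ : 0 < R₁)
    (hK : ∀ R, R₁ ≤ R → ∫ x, f x * (scaledCutoff n R x ^ (n + 2)) ^ 2 ≤ K) : Integrable f := by
  have hcov := aecover_closedBall (μ := volume) (x := (0 : Euc n)) tendsto_id
  refine hcov.integrable_of_integral_bounded_of_nonneg_ae K
    (fun R => hf.continuousOn.integrableOn_compact (isCompact_closedBall _ _))
    (Eventually.of_forall hf0) ?_
  filter_upwards [eventually_ge_atTop R₁] with R hR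
  have hR0 : 0 < R := hR₁.trans_le hR
  refine le_trans ?_ (hK R hR)
  have hi : Integrable fun x => f x * (scaledCutoff n R x ^ (n + 2)) ^ 2 := by
    simpa only [pow_mul] using integrable_mul_scaledCutoff_pow hf hR0
      (k := (n + 2) * 2) (by omega)
  calc ∫ x in closedBall 0 (id R), f x
      = ∫ x in closedBall 0 (id R), f x * (scaledCutoff n R x ^ (n + 2)) ^ 2 :=
        setIntegral_congr_fun measurableSet_closedBall fun x hx => by
          simp [scaledCutoff_eq_one hR0 (mem_closedBall_zero_iff.1 hx)]
    _ ≤ _ := setIntegral_le_integral hi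
        (Eventually.of_forall fun x => mul_nonneg (hf0 x) (sq_nonneg _))

lemma tendsto_integral_cutoff {f : Euc n → ℝ} (hf : Integrable f) :
    Tendsto (fun R => ∫ x, f x * (scaledCutoff n R x ^ (n + 2)) ^ 2) atTop (𝓝 (∫ x, f x)) := by
  refine tendsto_integral_filter_of_dominated_convergence (fun x => ‖f x‖) ?_ ?_ hf.norm ?_
  · exact Eventually.of_forall fun R => hf.aestronglyMeasurable.mul
      (((continuous_scaledCutoff R).pow _).pow 2).aestronglyMeasurable
  · refine Eventually.of_forall fun R => Eventually.of_forall fun x => ?_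
    rw [norm_mul, Real.norm_of_nonneg (sq_nonneg _), ← pow_mul]
    exact mul_le_of_le_one_right (norm_nonneg _)
      (pow_le_one₀ (scaledCutoff_nonneg R x) (scaledCutoff_le_one R x))
  · refine Eventually.of_forall fun x => tendsto_const_nhds.congr' ?_
    filter_upwards [eventually_ge_atTop (max 1 ‖x‖)] with R hR
    rw [scaledCutoff_eq_one (one_pos.trans_le ((le_max_left _ _).trans hR))
      ((le_max_right _ _).trans hR)]
    simp

lemma tendsto_cutoffError (hn : 5 ≤ n) (hp : p = ((n : ℝ) + 4) / ((n : ℝ) - 4))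
    (hu : Continuous u) (hi : Integrable fun x => ‖u x‖ ^ (p + 1)) :
    Tendsto (cutoffError u) atTop (𝓝 0) := by
  refine tendsto_order.2 ⟨fun a ha => Eventually.of_forall fun R =>
    ha.trans_le (cutoffError_nonneg R), fun a ha => ?_⟩
  set V := 2 ^ n * volume.real (ball (0 : Euc n) 1) with hV
  have hV0 : 0 ≤ V := by positivity
  set δ := a / (2 * (V + 1)) with hδ
  have hδ0 : 0 < δ := by positivity
  have hδV : δ * V < a := by
    rw [hδ, div_mul_eq_mul_div, div_lt_iff₀ (by positivity)]
    nlinarith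
  obtain ⟨C, hC, h⟩ := exists_critical_young_right hn hp hδ0
  let Y : ℝ → Euc n → ℝ := fun R x => ‖u x‖ ^ 2 * (R⁻¹ ^ 4 * scaledCutoff n R x ^ (2 * n))
  let I : ℝ → Euc n → ℝ := fun R => (ball (0 : Euc n) (2 * R)).indicator fun _ => δ * R⁻¹ ^ n
  have hYle : ∀ R x, Y R x ≤ ‖u x‖ ^ 2 * R⁻¹ ^ 4 := fun R x =>
    mul_le_mul_of_nonneg_left (mul_le_of_le_one_right (by positivity)
      (pow_le_one₀ (scaledCutoff_nonneg R x) (scaledCutoff_le_one R x))) (sq_nonneg _)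
  have hYc : ∀ R, Continuous (Y R) := fun R => (hu.norm.pow 2).mul
    (continuous_const.mul ((continuous_scaledCutoff R).pow _))
  have hII : ∀ R, Integrable (I R) := fun R => integrable_indicator_ball _ _
  have hI0 : ∀ R, 0 < R → ∀ x, 0 ≤ I R x := fun R hR x =>
    indicator_nonneg (fun _ _ => by positivity) x
  have hYI : ∀ R, 0 < R → Integrable (Y R) := fun R hR =>
    integrable_of_zero_off_tsupport (hYc R) (hasCompactSupport_scaledCutoff hR) fun x hx => by
      simp [Y, image_eq_zero_of_notMem_tsupport hx, show n ≠ 0 by omega]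
  have hlim : Tendsto (fun R => ∫ x, max (Y R x - I R x) 0) atTop (𝓝 0) := by
    rw [show 𝓝 (0 : ℝ) = 𝓝 (∫ _ : Euc n, (0 : ℝ)) by rw [integral_zero]]
    refine tendsto_integral_filter_of_dominated_convergence (fun x => C * ‖u x‖ ^ (p + 1))
      ?_ ?_ (hi.const_mul _) ?_
    · exact Eventually.of_forall fun R =>
        (((hYc R).aestronglyMeasurable.sub (hII R).aestronglyMeasurable).sup
          aestronglyMeasurable_const)
    · filter_upwards [eventually_gt_atTop 0] with R hR
      refine Eventually.of_forall fun x => ?_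
      rw [Real.norm_of_nonneg (le_max_right _ _)]
      refine max_le ?_ (by positivity)
      by_cases hx : x ∈ ball (0 : Euc n) (2 * R)
      · have h1 := h ‖u x‖ (scaledCutoff n R x) R⁻¹ (norm_nonneg _) (scaledCutoff_nonneg R x)
          (scaledCutoff_le_one R x) (by positivity)
        have h2 : I R x = δ * R⁻¹ ^ n := indicator_of_mem hx _
        have h3 : ‖u x‖ ^ (p + 1) * (scaledCutoff n R x ^ (n + 2)) ^ 2 ≤ ‖u x‖ ^ (p + 1) := by
          rw [← pow_mul]
          exact mul_le_of_le_one_right (by positivity)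
            (pow_le_one₀ (scaledCutoff_nonneg R x) (scaledCutoff_le_one R x))
        rw [h2, sub_le_iff_le_add]
        exact h1.trans (by gcongr)
      · have h2 : I R x = 0 := indicator_of_notMem hx _
        have h3 : Y R x = 0 := by
          simp [Y, scaledCutoff_eq_zero hR hx, show n ≠ 0 by omega]
        rw [h2, h3, sub_zero]
        positivity
    · refine Eventually.of_forall fun x => ?_
      have h0 : Tendsto (fun R : ℝ => ‖u x‖ ^ 2 * R⁻¹ ^ 4) atTop (𝓝 0) := by
        simpa using (tendsto_inv_atTop_zero.pow 4).const_mul (‖u x‖ ^ 2)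
      refine tendsto_of_tendsto_of_tendsto_of_le_of_le' tendsto_const_nhds h0
        (Eventually.of_forall fun R => le_max_right _ _) ?_
      filter_upwards [eventually_gt_atTop 0] with R hR
      exact max_le ((sub_le_self _ (hI0 R hR x)).trans (hYle R x)) (by positivity)
  filter_upwards [hlim.eventually_lt_const (sub_pos.2 hδV), eventually_gt_atTop 0] with R hR1 hR
  have hint : Integrable fun x => max (Y R x - I R x) 0 := ((hYI R hR).sub (hII R)).pos_part
  have hIint : ∫ x, I R x = δ * V := by
    rw [integral_indicator_const _ measurableSet_ball, smul_eq_mul, hV,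
      ← inv_pow_mul_volume_ball hR]
    ring
  calc cutoffError u R = ∫ x, Y R x := rfl
    _ ≤ ∫ x, (max (Y R x - I R x) 0 + I R x) := by
      refine integral_mono (hYI R hR) (hint.add (hII R)) fun x => ?_
      have := le_max_left (Y R x - I R x) 0
      change Y R x ≤ max (Y R x - I R x) 0 + I R x
      linarith
    _ = (∫ x, max (Y R x - I R x) 0) + δ * V := by rw [integral_add hint (hII R), hIint]
    _ < a := by linarith

lemma eq_zero_of_forall_le_mul {a b : ℝ} (ha : 0 ≤ a) (h : ∀ ε > 0, a ≤ ε * b) : a = 0 := by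
  refine le_antisymm (le_of_forall_pos_le_add fun ε hε => ?_) ha
  have h1 := h (ε / (|b| + 1)) (by positivity)
  have h2 : ε / (|b| + 1) * b ≤ ε := by
    rw [div_mul_eq_mul_div, div_le_iff₀ (by positivity)]
    nlinarith [le_abs_self b]
  linarith

end Limit

/-- Sobolev-critical part of Theorem 3.1: for `p = (n+4)/(n−4)`, a solution of
`Δ²u_i = |u|^{p−1} u_i` that is stable outside a compact set has finite energy
`∫ |u|^{p+1} = Σ_i ∫ |Δu_i|² < ∞`, and if moreover `u` is stable on all of `ℝⁿ`
then `u ≡ 0`. -/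
theorem statement10 (n m : ℕ) (hn : 5 ≤ n) (hm : 1 ≤ m) (p : ℝ)
    (hp : p = ((n : ℝ) + 4) / ((n : ℝ) - 4))
    (u : Euc n → EuclideanSpace ℝ (Fin m)) (hreg : ContDiff ℝ 4 u)
    (hsol : ∀ (i : Fin m) (x : Euc n),
      lap (fun z => lap (fun w => u w i) z) x = ‖u x‖ ^ (p - 1) * u x i)
    (hstab : ∃ R₀ : ℝ, 0 < R₀ ∧ Stable2 n m p u (closure (ball (0 : Euc n) R₀))ᶜ) :
    (Integrable (fun x => ‖u x‖ ^ (p + 1)) (volume : Measure (Euc n)) ∧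
      (∀ i : Fin m,
        Integrable (fun x => (lap (fun z => u z i) x) ^ 2) (volume : Measure (Euc n))) ∧
      ∫ x, ‖u x‖ ^ (p + 1) = ∑ i, ∫ x, (lap (fun z => u z i) x) ^ 2) ∧
    (Stable2 n m p u Set.univ → ∀ (i : Fin m) (x : Euc n), u x i = 0) := by
  have hp1 : 1 < p := by
    have h5 : (5 : ℝ) ≤ n := by exact_mod_cast hn
    rw [hp, one_lt_div (by linarith)]
    linarith
  obtain ⟨R₀, hR₀, hst⟩ := hstab
  have hu2 : ContDiff ℝ 2 u := hreg.of_le (by norm_num)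
  have hpu : Continuous fun x => ‖u x‖ ^ (p + 1) :=
    hreg.continuous.norm.rpow_const fun x => .inr (by linarith)
  have hlu : ∀ i, Continuous fun x => lap (fun z => u z i) x ^ 2 := fun i =>
    (hu2.euclidean_coord i).continuous_lap.pow 2
  obtain ⟨K, R₁, hR₁, hK⟩ := exists_cutoff_energy_bound hn hp hp1 hreg hsol hR₀ hst
  have hiB : Integrable fun x => ‖u x‖ ^ (p + 1) :=
    integrable_of_cutoff_bound hpu (fun x => by positivity) hR₁ fun R hR => (hK R hR).1
  have hiA : ∀ i, Integrable fun x => lap (fun z => u z i) x ^ 2 := fun i => by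
    refine integrable_of_cutoff_bound (hlu i) (fun x => sq_nonneg _) hR₁ fun R hR =>
      le_trans ?_ (hK R hR).2
    simp only [mul_comm (lap _ _ ^ 2)]
    exact Finset.single_le_sum
      (f := fun i => ∫ x, (scaledCutoff n R x ^ (n + 2)) ^ 2 * lap (fun y => u y i) x ^ 2)
      (fun _ _ => integral_nonneg fun _ => by positivity) (Finset.mem_univ i)
  have tB : Tendsto (cutoffPotential p u) atTop (𝓝 (∫ x, ‖u x‖ ^ (p + 1))) :=
    tendsto_integral_cutoff hiB
  have tA : Tendsto (cutoffBending u) atTop (𝓝 (∑ i, ∫ x, lap (fun z => u z i) x ^ 2)) := by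
    refine tendsto_finsetSum _ fun i _ => ?_
    simpa only [mul_comm] using tendsto_integral_cutoff (hiA i)
  have tY := tendsto_cutoffError hn hp hreg.continuous hiB
  refine ⟨⟨hiB, hiA, ?_⟩, fun hstu => ?_⟩
  · refine sub_eq_zero.1 (abs_eq_zero.1 (eq_zero_of_forall_le_mul (abs_nonneg _)
      (b := ∑ i, ∫ x, lap (fun z => u z i) x ^ 2) fun ε hε => ?_))
    obtain ⟨C, -, hE⟩ := exists_cutoff_estimates hε (by omega) hp1 hreg hsol
    refine le_of_tendsto_of_tendsto (tB.sub tA).abs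
      (by simpa using (tA.const_mul ε).add (tY.const_mul C)) ?_
    filter_upwards [eventually_gt_atTop 0] with R hR using (hE R hR).2
  · have h0 : (p - 1) * ∫ x, ‖u x‖ ^ (p + 1) = 0 := by
      refine eq_zero_of_forall_le_mul (b := ∑ i, ∫ x, lap (fun z => u z i) x ^ 2)
        (mul_nonneg (by linarith) (integral_nonneg fun x => by positivity)) fun ε hε => ?_
      obtain ⟨C, -, hE⟩ := exists_cutoff_estimates hε (by omega) hp1 hreg hsol
      refine le_of_tendsto_of_tendsto (tB.const_mul (p - 1))
        (by simpa using (tA.const_mul ε).add (tY.const_mul C)) ?_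
      filter_upwards [eventually_gt_atTop 0] with R hR
      have h1 := hstu.integral_le_of_scalar isOpen_univ hp1 hu2
        (ξ := fun x => scaledCutoff n R x ^ (n + 2)) ((contDiff_scaledCutoff (k := 2) R).pow _)
        ((hasCompactSupport_scaledCutoff hR).comp_left (g := fun t : ℝ => t ^ (n + 2)) (by simp))
        (subset_univ _)
      change p * cutoffPotential p u R ≤ _ at h1
      linarith [(hE R hR).1]
    have h2 : ∫ x, ‖u x‖ ^ (p + 1) = 0 := (mul_eq_zero.1 h0).resolve_left (by linarith)
    rw [integral_eq_zero_iff_of_nonneg (fun x => by positivity) hiB,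
      hpu.ae_eq_iff_eq volume continuous_zero] at h2
    intro i x
    have h3 : u x = 0 :=
      norm_eq_zero.1 ((rpow_eq_zero (norm_nonneg _) (by linarith)).1 (congrFun h2 x))
    simp [h3]
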